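/- Let X_free be a compact, path-connected subset of ℝ² equal to a finite union of convex polygons in which every path-homotopy class contains a path of minimal cost. Fix an anchor x⋆, tether length ζ ≥ 0, a home configuration ς_s (a path from x⋆ to x_s with c(ς_s) ≤ ζ), and goals x₁,…,x_N ∈ X_free. Call γ a feasible TMV loop if γ = σ_1 * … * σ_{N+1} where each σ_i is a path in X_free from x_{i−1} to x_i (with x_0 = x_{N+1} = x_s), m[ς_s * γ_{[0,t]}] ≤ ζ for all t ∈ [0,1], and ς_s * γ ≃_p ς_s. If γ* = σ_1 * … * σ_{N+1} is a feasible TMV loop with c(γ*) ≤ c(γ) for every feasible TMV loop γ, then every subpath σ_i (i = 1,…,N+1) is an optimal homotopic path, i.e., c(σ_i) ≤ c(σ′) for every path σ′ in X_free with σ′ ≃_p σ_i. -/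

import Mathlib

noncomputable section

/-- Points of the plane. -/
abbrev E2 : Type := EuclideanSpace ℝ (Fin 2)

namespace THPP

lemma subIcc_mem (s t₁ t₂ : unitInterval) :
    (1 - s.1) * t₁.1 + s.1 * t₂.1 ∈ Set.Icc (0 : ℝ) 1 := by
  have hs0 : (0:ℝ) ≤ s.1 := s.2.1
  have hs1 : s.1 ≤ 1 := s.2.2
  have ha0 : (0:ℝ) ≤ t₁.1 := t₁.2.1
  have ha1 : t₁.1 ≤ 1 := t₁.2.2
  have hb0 : (0:ℝ) ≤ t₂.1 := t₂.2.1
  have hb1 : t₂.1 ≤ 1 := t₂.2.2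
  constructor
  · have h1 := mul_nonneg (by linarith : (0:ℝ) ≤ 1 - s.1) ha0
    have h2 := mul_nonneg hs0 hb0
    linarith
  · have h1 := mul_nonneg (by linarith : (0:ℝ) ≤ 1 - s.1) (by linarith : (0:ℝ) ≤ 1 - t₁.1)
    have h2 := mul_nonneg hs0 (by linarith : (0:ℝ) ≤ 1 - t₂.1)
    nlinarith

/-- The subpath `σ_{[t₁,t₂]} : s ↦ σ ((1-s)·t₁ + s·t₂)`. -/
def subpath {Y : Type*} [TopologicalSpace Y] {a b : Y} (σ : Path a b) (t₁ t₂ : unitInterval) :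
    Path (σ t₁) (σ t₂) where
  toFun s := σ ⟨(1 - s.1) * t₁.1 + s.1 * t₂.1, subIcc_mem s t₁ t₂⟩
  continuous_toFun := σ.continuous.comp (Continuous.subtype_mk (by fun_prop) _)
  source' := by
    exact congrArg (fun u => σ u) (Subtype.ext (by simp))
  target' := by
    exact congrArg (fun u => σ u) (Subtype.ext (by simp))

/-- The subpath `σ_{[0,t]}`, as a path from the start point of `σ` to `σ t`. -/
def subpath0 {Y : Type*} [TopologicalSpace Y] {a b : Y} (σ : Path a b) (t : unitInterval) :
    Path a (σ t) :=
  (subpath σ 0 t).cast σ.source.symm rfl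

/-- The straight-line path `t ↦ (1-t)·x₀ + t·x₁`, as a path in `X` given that the
segment `[x₀, x₁]` is contained in `X`. -/
def linePath {X : Set E2} {x₀ x₁ : E2} (h₀ : x₀ ∈ X) (h₁ : x₁ ∈ X)
    (hseg : segment ℝ x₀ x₁ ⊆ X) : Path (⟨x₀, h₀⟩ : X) ⟨x₁, h₁⟩ where
  toFun t := ⟨(1 - t.1) • x₀ + t.1 • x₁,
    hseg (by rw [segment_eq_image]; exact ⟨t.1, t.2, rfl⟩)⟩
  continuous_toFun := Continuous.subtype_mk (by fun_prop) _
  source' := Subtype.ext (by simp)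
  target' := Subtype.ext (by simp)

/-- The cost (arc length) of a path in a subset of the plane: the total variation of the
underlying map `[0,1] → ℝ²`. -/
def cost {X : Set E2} {a b : X} (σ : Path a b) : ENNReal :=
  eVariationOn (fun t => (σ t : E2)) Set.univ

/-- A path is an optimal homotopic path if it has minimal cost within its
path-homotopy class (homotopies staying in `X`). -/
def IsOptimal {X : Set E2} {a b : X} (σ : Path a b) : Prop :=
  ∀ σ' : Path a b, σ.Homotopic σ' → cost σ ≤ cost σ'

/-- `m[σ]`: the infimal cost of the path-homotopy class of `σ`. -/
def mCost {X : Set E2} {a b : X} (σ : Path a b) : ENNReal :=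
  ⨅ σ' : {σ' : Path a b // σ.Homotopic σ'}, cost σ'.1

/-- Concatenation `σ₀ * σ₁ * ⋯ * σ_{n-1}` of a chain of paths. -/
def chain {Y : Type*} [TopologicalSpace Y] (x : ℕ → Y)
    (σ : ∀ i : ℕ, Path (x i) (x (i + 1))) : ∀ n : ℕ, Path (x 0) (x n)
  | 0 => Path.refl (x 0)
  | n + 1 => (chain x σ n).trans (σ n)


/-- A family `σ` of connecting paths is a feasible TMV loop for home configuration
`ςs` and tether length ζ: the taut tether length stays within ζ along the loop
`γ = σ₀ * ⋯ * σ_N`, and the final configuration is homotopic to the home one. -/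
def FeasibleTMV {X : Set E2} {xstar : X} (ζ : ℝ) (N : ℕ) (x : ℕ → X)
    (hxN : x (N + 1) = x 0) (ςs : Path xstar (x 0))
    (σ : ∀ i : ℕ, Path (x i) (x (i + 1))) : Prop :=
  (∀ t : unitInterval,
      mCost (ςs.trans (subpath0 (chain x σ (N + 1)) t)) ≤ ENNReal.ofReal ζ) ∧
  (ςs.trans (chain x σ (N + 1))).Homotopic (ςs.cast rfl hxN)

section

def det2 (w u : E2) : ℝ := w 0 * u 1 - w 1 * u 0

lemma det2_zero {w u : E2} (hw : w ≠ 0) (h : det2 w u = 0) : ∃ l : ℝ, u = l • w := by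
  unfold det2 at h
  have hne : w 0 ^ 2 + w 1 ^ 2 ≠ 0 := by
    intro h0
    apply hw
    have h1 : w 0 = 0 := by nlinarith [sq_nonneg (w 0), sq_nonneg (w 1)]
    have h2 : w 1 = 0 := by nlinarith [sq_nonneg (w 0), sq_nonneg (w 1)]
    ext i; fin_cases i <;> simp [h1, h2]
  refine ⟨(w 0 * u 0 + w 1 * u 1) / (w 0 ^ 2 + w 1 ^ 2), ?_⟩
  ext i; fin_cases i
  · simp only [Fin.zero_eta, PiLp.smul_apply, smul_eq_mul]
    field_simp
    linear_combination (-w 1) * h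
  · simp only [Fin.mk_one, PiLp.smul_apply, smul_eq_mul]
    field_simp
    linear_combination (w 0) * h

lemma det2_comb (w x y : E2) (r : ℝ) :
    det2 w ((1 - r) • x + r • y) = (1 - r) * det2 w x + r * det2 w y := by
  simp [det2]; ring

lemma exists_cross {w x y : E2} (h : det2 w x * det2 w y ≤ 0) :
    ∃ r : ℝ, 0 ≤ r ∧ r ≤ 1 ∧ det2 w ((1 - r) • x + r • y) = 0 := by
  by_cases h0 : det2 w x = 0
  · exact ⟨0, le_rfl, zero_le_one, by simp [h0]⟩
  · have hpos : 0 < det2 w x ^ 2 := by positivity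
    set A := det2 w x with hA
    set B := det2 w y with hB
    have hAB : 0 < A * (A - B) := by nlinarith
    have hne : A - B ≠ 0 := fun hh => by simp [hh] at hAB
    refine ⟨A / (A - B), ?_, ?_, ?_⟩
    · have : A / (A - B) = A * (A - B) / (A - B) ^ 2 := by field_simp
      rw [this]; positivity
    · have : 1 - A / (A - B) = (-(A * B) + B ^ 2) / (A - B) ^ 2 := by field_simp; ring
      have h2 : 0 ≤ (-(A * B) + B ^ 2) / (A - B) ^ 2 := by
        apply div_nonneg <;> nlinarith [sq_nonneg B, sq_nonneg (A - B)]
      linarith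
    · rw [det2_comb, ← hA, ← hB]; field_simp; ring

/-- conic neighbourhoods centred at the origin -/
structure ConeNhd (S : Set E2) (ε : ℝ) : Prop where
  zero : (0 : E2) ∈ S
  lt : ∀ u ∈ S, ‖u‖ < ε
  smul : ∀ u ∈ S, ∀ c : ℝ, 0 ≤ c → ‖c • u‖ < ε → c • u ∈ S

def Seg (S : Set E2) (x y : E2) : Prop :=
  ∀ r : ℝ, 0 ≤ r → r ≤ 1 → (1 - r) • x + r • y ∈ S

lemma Seg.symm {S : Set E2} {x y : E2} (h : Seg S x y) : Seg S y x := by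
  intro r h0 h1
  have := h (1 - r) (by linarith) (by linarith)
  rwa [sub_sub_cancel, add_comm] at this

lemma cone_norm_lt {S : Set E2} {ε : ℝ} (hS : ConeNhd S ε) {x y : E2} (hx : x ∈ S) (hy : y ∈ S)
    {r : ℝ} (h0 : 0 ≤ r) (h1 : r ≤ 1) : ‖(1 - r) • x + r • y‖ < ε := by
  have := (convex_ball (0 : E2) ε) (by simpa using hS.lt x hx) (by simpa using hS.lt y hy)
    (sub_nonneg.2 h1) h0 (by ring)
  simpa using this

lemma cone_aux {S : Set E2} {ε : ℝ} (hS : ConeNhd S ε) {x y z : E2} {r s : ℝ}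
    (hr0 : 0 ≤ r) (hr1 : r ≤ 1) (hs0 : 0 ≤ s) (hs1 : s ≤ 1)
    (hu : (1 - r) • x + r • y ∈ S) (hw : (1 - s) • y + s • z ∉ S)
    (hwε : ‖(1 - s) • y + s • z‖ < ε)
    (hd : det2 ((1 - s) • y + s • z) ((1 - r) • x + r • y) = 0) :
    ∃ a b c : ℝ, 0 ≤ a ∧ 0 ≤ b ∧ 0 ≤ c ∧ a + b + c = 1 ∧ a • x + b • y + c • z = 0 := by
  have hw0 : (1 - s) • y + s • z ≠ 0 := fun h => hw (h ▸ hS.zero)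
  obtain ⟨l, hl⟩ := det2_zero hw0 hd
  rcases le_or_gt l 0 with hl0 | hl0
  · have h1l : 0 < 1 - l := by linarith
    refine ⟨(1 - r) / (1 - l), (r + (-l) * (1 - s)) / (1 - l), (-l) * s / (1 - l), ?_, ?_, ?_, ?_, ?_⟩
    · apply div_nonneg <;> linarith
    · apply div_nonneg
      · have := mul_nonneg (neg_nonneg.2 hl0) (sub_nonneg.2 hs1); linarith
      · linarith
    · apply div_nonneg
      · exact mul_nonneg (neg_nonneg.2 hl0) hs0
      · linarith
    · field_simp; ring
    · have h2 : ((1 - r) / (1 - l)) • x + ((r + (-l) * (1 - s)) / (1 - l)) • y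
          + ((-l) * s / (1 - l)) • z
          = (1 / (1 - l)) • (((1 - r) • x + r • y) - l • ((1 - s) • y + s • z)) := by
        module
      rw [h2, hl, sub_self, smul_zero]
  · exfalso
    apply hw
    have h3 : (1 - s) • y + s • z = l⁻¹ • ((1 - r) • x + r • y) := by
      rw [hl, smul_smul, inv_mul_cancel₀ hl0.ne', one_smul]
    rw [h3]
    apply hS.smul _ hu _ (inv_nonneg.2 hl0.le)
    rw [← h3]; exact hwε

lemma cone_tri {S : Set E2} {ε : ℝ} (hS : ConeNhd S ε) {x y z : E2}
    (hy : y ∈ S) (hz : z ∈ S) (hxy : Seg S x y) (hxz : Seg S x z)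
    (hyz : ¬ Seg S y z) :
    ∃ a b c : ℝ, 0 ≤ a ∧ 0 ≤ b ∧ 0 ≤ c ∧ a + b + c = 1 ∧ a • x + b • y + c • z = 0 := by
  unfold Seg at hyz
  push Not at hyz
  obtain ⟨s, hs0, hs1, hw⟩ := hyz
  have hwε := cone_norm_lt hS hy hz hs0 hs1
  set w := (1 - s) • y + s • z with hwdef
  have hww : (1 - s) * det2 w y + s * det2 w z = 0 := by
    rw [← det2_comb, ← hwdef]; simp [det2]; ring
  have key : det2 w x * det2 w y ≤ 0 ∨ det2 w x * det2 w z ≤ 0 := by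
    by_contra hcon
    push Not at hcon
    have h1 : 0 < det2 w x ^ 2 := by
      have : det2 w x ≠ 0 := fun h => by simp [h] at hcon
      positivity
    have h2 : (1 - s) * (det2 w x * det2 w y) + s * (det2 w x * det2 w z) = 0 := by
      linear_combination (det2 w x) * hww
    rcases eq_or_lt_of_le hs0 with h | h
    · subst h; simp at h2; rcases h2 with h2 | h2 <;> simp [h2] at hcon
    · have := mul_pos h hcon.2
      have := mul_nonneg (sub_nonneg.2 hs1) hcon.1.le
      linarith
  rcases key with h | h
  · obtain ⟨r, hr0, hr1, hd⟩ := exists_cross h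
    exact cone_aux hS hr0 hr1 hs0 hs1 (hxy r hr0 hr1) hw hwε hd
  · obtain ⟨r, hr0, hr1, hd⟩ := exists_cross h
    have e : (1 - (1 - s)) • z + (1 - s) • y = w := by rw [hwdef]; module
    obtain ⟨a, b, c, ha, hb, hc, h1, h2⟩ := cone_aux hS (x := x) (y := z) (z := y) (r := r)
      (s := 1 - s) hr0 hr1 (by linarith) (by linarith) (hxz r hr0 hr1) (by rwa [e]) (by rwa [e])
      (by rwa [e])
    exact ⟨a, c, b, ha, hc, hb, by linarith, by rw [← h2]; abel⟩

lemma seg_of_smul {S : Set E2} {ε : ℝ} (hS : ConeNhd S ε) {x y : E2} (h : Seg S x y)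
    {c : ℝ} (h0 : 0 ≤ c) (h1 : c ≤ 1) : Seg S x (c • y) := by
  intro r hr0 hr1
  -- (1-r) x + r c y = t * ((1-r)/t x + r c / t y), t = 1 - r + r c
  have hx : x ∈ S := by simpa using h 0 le_rfl zero_le_one
  have hy : y ∈ S := by simpa using h 1 zero_le_one le_rfl
  rcases eq_or_lt_of_le (show 0 ≤ 1 - r + r * c by nlinarith [mul_nonneg hr0 h0]) with ht | ht
  · have : r = 1 := by nlinarith [mul_nonneg hr0 h0]
    subst this
    have : c = 0 := by linarith
    subst this
    simpa using hS.zero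
  · have ht1 : 1 - r + r * c ≤ 1 := by nlinarith
    have hm := h (r * c / (1 - r + r * c)) (div_nonneg (mul_nonneg hr0 h0) ht.le)
      (by rw [div_le_one ht]; linarith)
    have e : (1 - r) • x + r • c • y = (1 - r + r * c) •
      ((1 - r * c / (1 - r + r * c)) • x + (r * c / (1 - r + r * c)) • y) := by
      rw [smul_add, smul_smul, smul_smul, smul_smul]
      congr 2
      · field_simp; ring
      · field_simp
    rw [e]
    apply hS.smul _ hm _ ht.le
    rw [norm_smul, Real.norm_of_nonneg ht.le]
    calc _ ≤ 1 * ‖_‖ := by gcongr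
      _ < ε := by rw [one_mul]; exact hS.lt _ hm

lemma seg_self {S : Set E2} {x : E2} (hx : x ∈ S) : Seg S x x := by
  intro r _ _
  have : (1 - r) • x + r • x = x := by module
  rwa [this]

lemma seg_zero {S : Set E2} {ε : ℝ} (hS : ConeNhd S ε) {x : E2} (hx : x ∈ S) : Seg S x 0 := by
  simpa using seg_of_smul hS (seg_self hx) le_rfl zero_le_one

open Classical in
def dS (S : Set E2) (x y : E2) : ℝ := if Seg S x y then ‖x - y‖ else ‖x‖ + ‖y‖

lemma dS_pos {S : Set E2} {x y : E2} (h : Seg S x y) : dS S x y = ‖x - y‖ := by simp [dS, h]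
lemma dS_neg {S : Set E2} {x y : E2} (h : ¬ Seg S x y) : dS S x y = ‖x‖ + ‖y‖ := by simp [dS, h]
lemma dS_le (S : Set E2) (x y : E2) : dS S x y ≤ ‖x‖ + ‖y‖ := by
  unfold dS; split_ifs
  · exact norm_sub_le _ _
  · exact le_rfl
lemma le_dS (S : Set E2) (x y : E2) : ‖x - y‖ ≤ dS S x y := by
  unfold dS; split_ifs
  · exact le_rfl
  · exact norm_sub_le _ _
lemma dS_comm (S : Set E2) (x y : E2) : dS S x y = dS S y x := by
  by_cases h : Seg S x y
  · rw [dS_pos h, dS_pos h.symm, norm_sub_rev]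
  · rw [dS_neg h, dS_neg (fun h' => h h'.symm), add_comm]

lemma key1 {x y m : E2} (hm : m ≠ 0) {a b c : ℝ} (ha : 0 ≤ a) (hb : 0 ≤ b) (hc : 0 ≤ c)
    (h1 : a + b + c = 1) (h : a • x + b • y + c • m = 0) :
    ‖x‖ * inner ℝ m y + ‖m‖ * inner ℝ x y ≤ 0 := by
  have hm0 : 0 < ‖m‖ := norm_pos_iff.2 hm
  have hCS := abs_real_inner_le_norm m y
  have hCS1 := (abs_le.1 hCS).1
  have hCS2 := (abs_le.1 hCS).2
  rcases eq_or_lt_of_le ha with h0 | h0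
  · subst h0
    have hb0 : b ≠ 0 := by
      rintro rfl
      have : c = 1 := by linarith
      subst this
      simp at h; exact hm h
    have hy : y = (-(c / b)) • m := by
      have : b • y = -(c • m) := by
        rw [zero_smul, zero_add] at h; exact eq_neg_of_add_eq_zero_left h
      have h2 : y = b⁻¹ • (b • y) := by rw [smul_smul, inv_mul_cancel₀ hb0, one_smul]
      rw [h2, this]; module
    rw [hy, inner_smul_right, inner_smul_right, real_inner_self_eq_norm_sq]
    have hk : 0 ≤ c / b := by positivity
    have h3 := (abs_le.1 (abs_real_inner_le_norm x m)).1
    have : 0 ≤ (c / b) * (‖m‖ * (‖x‖ * ‖m‖ + inner ℝ x m)) := by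
      apply mul_nonneg hk (mul_nonneg hm0.le (by linarith))
    nlinarith
  · have hxv : a • x = -(b • y + c • m) := by
      rw [add_assoc] at h; exact eq_neg_of_add_eq_zero_left h
    have hn : a * ‖x‖ = ‖b • y + c • m‖ := by
      rw [← norm_neg (b • y + c • m), ← hxv, norm_smul, Real.norm_of_nonneg ha]
    have hi : a * inner ℝ x y = -(b * ‖y‖ ^ 2 + c * inner ℝ m y) := by
      rw [← real_inner_smul_left, hxv, inner_neg_left, inner_add_left, real_inner_smul_left,
        real_inner_smul_left, real_inner_self_eq_norm_sq]
    have hby : ‖b • y‖ = b * ‖y‖ := by rw [norm_smul, Real.norm_of_nonneg hb]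
    have hcm : ‖c • m‖ = c * ‖m‖ := by rw [norm_smul, Real.norm_of_nonneg hc]
    have hup := norm_add_le (b • y) (c • m)
    have hlo : c * ‖m‖ - b * ‖y‖ ≤ ‖b • y + c • m‖ := by
      have := norm_sub_norm_le (c • m) (-(b • y))
      rw [norm_neg, sub_neg_eq_add, add_comm (c • m), hby, hcm] at this
      exact this
    rw [hby, hcm] at hup
    have hgoal : a * (‖x‖ * inner ℝ m y + ‖m‖ * inner ℝ x y) ≤ 0 := by
      have : a * (‖x‖ * inner ℝ m y + ‖m‖ * inner ℝ x y) =
        ‖b • y + c • m‖ * inner ℝ m y - ‖m‖ * (b * ‖y‖ ^ 2 + c * inner ℝ m y) := by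
        linear_combination (inner ℝ m y) * hn + ‖m‖ * hi
      rw [this]
      have hby0 : 0 ≤ b * ‖y‖ := by positivity
      rcases le_or_gt 0 (inner ℝ m y) with hs | hs
      · have := mul_le_mul_of_nonneg_right hup hs
        have := mul_le_mul_of_nonneg_left hCS2 hby0
        nlinarith
      · have := mul_le_mul_of_nonpos_right hlo hs.le
        have := mul_le_mul_of_nonneg_left hCS1 hby0
        nlinarith
    by_contra hcon
    push Not at hcon
    have := mul_pos h0 hcon
    linarith

lemma key2 {x y z : E2} {a b c : ℝ} (ha : 0 ≤ a) (hb : 0 ≤ b) (hc : 0 ≤ c)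
    (h1 : a + b + c = 1) (h : a • x + b • y + c • z = 0) :
    ‖z‖ * inner ℝ x y + ‖y‖ * inner ℝ x z ≤ 0 := by
  have hCS := abs_real_inner_le_norm y z
  have hCS1 := (abs_le.1 hCS).1
  have hx : a • x = -(b • y + c • z) := by
    rw [add_assoc] at h; exact eq_neg_of_add_eq_zero_left h
  rcases eq_or_lt_of_le ha with h0 | h0
  · subst h0
    have e : b • y = -(c • z) := by
      rw [zero_smul, zero_add] at h; exact eq_neg_of_add_eq_zero_left h
    have hn : b * ‖y‖ = c * ‖z‖ := by
      have := congrArg norm e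
      rwa [norm_neg, norm_smul, norm_smul, Real.norm_of_nonneg hb, Real.norm_of_nonneg hc] at this
    have hi : b * inner ℝ x y = -(c * inner ℝ x z) := by
      rw [← real_inner_smul_right, e, inner_neg_right, real_inner_smul_right]
    -- multiply by b + c = 1
    have hbc : b + c = 1 := by linarith
    have hz : ‖z‖ * inner ℝ x y + ‖y‖ * inner ℝ x z =
        (b + c) * (‖z‖ * inner ℝ x y + ‖y‖ * inner ℝ x z) := by rw [hbc, one_mul]
    have : (b + c) * (‖z‖ * inner ℝ x y + ‖y‖ * inner ℝ x z) = 0 := by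
      linear_combination ‖z‖ * hi + inner ℝ x z * hn  - inner ℝ x y * hn + ‖y‖ * hi
    linarith
  · have hiy : a * inner ℝ x y = -(b * ‖y‖ ^ 2 + c * inner ℝ y z) := by
      rw [← real_inner_smul_left, hx, inner_neg_left, inner_add_left, real_inner_smul_left,
        real_inner_smul_left, real_inner_self_eq_norm_sq, real_inner_comm z y]
    have hiz : a * inner ℝ x z = -(b * inner ℝ y z + c * ‖z‖ ^ 2) := by
      rw [← real_inner_smul_left, hx, inner_neg_left, inner_add_left, real_inner_smul_left,
        real_inner_smul_left, real_inner_self_eq_norm_sq]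
    have : a * (‖z‖ * inner ℝ x y + ‖y‖ * inner ℝ x z) =
        - ((b * ‖y‖ + c * ‖z‖) * (‖y‖ * ‖z‖ + inner ℝ y z)) := by
      linear_combination ‖z‖ * hiy + ‖y‖ * hiz
    have h2 : 0 ≤ (b * ‖y‖ + c * ‖z‖) * (‖y‖ * ‖z‖ + inner ℝ y z) := by
      apply mul_nonneg (by positivity) (by linarith)
    by_contra hcon
    push Not at hcon
    have := mul_pos h0 hcon
    linarith

lemma cone_CN_B {S : Set E2} {ε : ℝ} (hS : ConeNhd S ε) {y z : E2} (hy : y ∈ S) (hz : z ∈ S)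
    (hyz : ¬ Seg S y z) (hle : ‖z‖ ≤ ‖y‖) :
    ∃ m ∈ S, dS S y m ≤ dS S y z / 2 ∧ dS S m z ≤ dS S y z / 2 ∧ ‖m‖ ≤ max ‖y‖ ‖z‖ ∧
      ∀ x ∈ S, dS S x m ^ 2 ≤ dS S x y ^ 2 / 2 + dS S x z ^ 2 / 2 - dS S y z ^ 2 / 4 := by
  have hy0 : y ≠ 0 := by
    rintro rfl; exact hyz (seg_zero hS hz).symm
  have hyp : 0 < ‖y‖ := norm_pos_iff.2 hy0
  set μ : ℝ := (‖y‖ - ‖z‖) / (2 * ‖y‖) with hμ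
  have hμ0 : 0 ≤ μ := div_nonneg (by linarith) (by linarith)
  have hμ1 : μ ≤ 1 := by
    rw [hμ, div_le_one (by linarith)]; linarith [norm_nonneg z]
  have hμy : μ * ‖y‖ = (‖y‖ - ‖z‖) / 2 := by rw [hμ]; field_simp
  have hnm : ‖μ • y‖ = (‖y‖ - ‖z‖) / 2 := by
    rw [norm_smul, Real.norm_of_nonneg hμ0, hμy]
  have hmS : μ • y ∈ S := hS.smul y hy μ hμ0 (by rw [hnm]; linarith [hS.lt y hy, norm_nonneg z])
  refine ⟨μ • y, hmS, ?_, ?_, ?_, ?_⟩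
  · rw [dS_neg hyz, dS_pos (seg_of_smul hS (seg_self hy) hμ0 hμ1)]
    have : y - μ • y = (1 - μ) • y := by module
    rw [this, norm_smul, Real.norm_of_nonneg (by linarith), sub_mul, hμy]; linarith
  · rw [dS_neg hyz]
    refine (dS_le _ _ _).trans ?_
    rw [hnm]; linarith
  · rw [hnm]; refine le_trans ?_ (le_max_left _ _); linarith [norm_nonneg z]
  · intro x hx
    rw [dS_neg hyz]
    have hμyz : (1 - 2 * μ) * ‖y‖ = ‖z‖ := by linarith
    by_cases hxy : Seg S x y
    · rw [dS_pos (seg_of_smul hS hxy hμ0 hμ1), dS_pos hxy]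
      have e1 : ‖x - μ • y‖ ^ 2 = ‖x‖ ^ 2 - 2 * (μ * inner ℝ x y) + (μ * ‖y‖) ^ 2 := by
        rw [norm_sub_sq_real, real_inner_smul_right, norm_smul, Real.norm_of_nonneg hμ0]
      have e2 := norm_sub_sq_real x y
      rw [e1, e2, hμy]
      have hCS := (abs_le.1 (abs_real_inner_le_norm x y)).2
      by_cases hxz : Seg S x z
      · obtain ⟨a, b, c, ha, hb, hc, h1, h⟩ := cone_tri hS hy hz hxy hxz hyz
        have k := key2 ha hb hc h1 h
        rw [dS_pos hxz, norm_sub_sq_real x z]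
        have : ‖y‖ * ((1 - 2 * μ) * inner ℝ x y + inner ℝ x z) ≤ 0 := by
          calc _ = ‖z‖ * inner ℝ x y + ‖y‖ * inner ℝ x z := by
                linear_combination (inner ℝ x y) * hμyz
            _ ≤ 0 := k
        have h3 : (1 - 2 * μ) * inner ℝ x y + inner ℝ x z ≤ 0 := by
          by_contra hcon
          push Not at hcon
          have := mul_pos hyp hcon
          linarith
        nlinarith
      · rw [dS_neg hxz]
        have h12 : 0 ≤ 1 - 2 * μ := by
          have : 0 ≤ (1 - 2 * μ) * ‖y‖ := by rw [hμyz]; exact norm_nonneg _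
          exact nonneg_of_mul_nonneg_left this hyp
        have : (1 - 2 * μ) * inner ℝ x y ≤ ‖x‖ * ‖z‖ := by
          calc _ ≤ (1 - 2 * μ) * (‖x‖ * ‖y‖) := by gcongr
            _ = ‖x‖ * ‖z‖ := by rw [← hμyz]; ring
        nlinarith
    · rw [dS_neg hxy]
      have h1 := dS_le S x (μ • y)
      rw [hnm] at h1
      have h0 : 0 ≤ dS S x (μ • y) := (norm_nonneg _).trans (le_dS _ _ _)
      have h2 : dS S x (μ • y) ^ 2 ≤ (‖x‖ + (‖y‖ - ‖z‖) / 2) ^ 2 := by gcongr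
      refine h2.trans ?_
      have h3 := le_dS S x z
      have h4 : ‖x - z‖ ^ 2 ≤ dS S x z ^ 2 := by gcongr
      rw [norm_sub_sq_real] at h4
      have hCS := (abs_le.1 (abs_real_inner_le_norm x z)).2
      nlinarith

lemma cone_CN_A {S : Set E2} {ε : ℝ} (hS : ConeNhd S ε) {y z : E2} (hy : y ∈ S) (hz : z ∈ S)
    (hyz : Seg S y z) :
    ∃ m ∈ S, dS S y m ≤ dS S y z / 2 ∧ dS S m z ≤ dS S y z / 2 ∧ ‖m‖ ≤ max ‖y‖ ‖z‖ ∧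
      ∀ x ∈ S, dS S x m ^ 2 ≤ dS S x y ^ 2 / 2 + dS S x z ^ 2 / 2 - dS S y z ^ 2 / 4 := by
  obtain ⟨m, hm⟩ : ∃ m : E2, m = (1 / 2 : ℝ) • (y + z) := ⟨_, rfl⟩
  have hmS : m ∈ S := by
    have := hyz (1 / 2) (by norm_num) (by norm_num)
    convert this using 1; rw [hm]; module
  have hym : Seg S y m := by
    intro r h0 h1
    have := hyz (r / 2) (by linarith) (by linarith)
    convert this using 1; rw [hm]; module
  have hzm : Seg S z m := by
    intro r h0 h1
    have := hyz (1 - r / 2) (by linarith) (by linarith)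
    convert this using 1; rw [hm]; module
  have h2m : y + z = (2 : ℝ) • m := by rw [hm]; module
  have iy : ∀ v : E2, 2 * inner ℝ v m = inner ℝ v y + inner ℝ v z := by
    intro v; rw [← inner_add_right, h2m, real_inner_smul_right]
  have par : ‖m‖ ^ 2 = ‖y‖ ^ 2 / 2 + ‖z‖ ^ 2 / 2 - ‖y - z‖ ^ 2 / 4 := by
    have := norm_add_sq_real y z
    rw [h2m, norm_smul] at this
    rw [norm_sub_sq_real]; norm_num at this; linarith
  have hmle : 2 * ‖m‖ ≤ ‖y‖ + ‖z‖ := by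
    have := norm_add_le y z
    rw [h2m, norm_smul] at this; norm_num at this; linarith
  refine ⟨m, hmS, ?_, ?_, ?_, ?_⟩
  · rw [dS_pos hym, dS_pos hyz]
    have : y - m = (1 / 2 : ℝ) • (y - z) := by rw [hm]; module
    rw [this, norm_smul]; norm_num; linarith
  · rw [dS_pos hzm.symm, dS_pos hyz]
    have : m - z = (1 / 2 : ℝ) • (y - z) := by rw [hm]; module
    rw [this, norm_smul]; norm_num; linarith
  · rcases le_total ‖y‖ ‖z‖ with h | h
    · rw [max_eq_right h]; linarith
    · rw [max_eq_left h]; linarith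
  · intro x hx
    rw [dS_pos hyz]
    by_cases hxm : Seg S x m
    · rw [dS_pos hxm]
      have h1 : ‖x - y‖ ^ 2 ≤ dS S x y ^ 2 := by gcongr; exact le_dS _ _ _
      have h2 : ‖x - z‖ ^ 2 ≤ dS S x z ^ 2 := by gcongr; exact le_dS _ _ _
      have e1 := norm_sub_sq_real x y
      have e2 := norm_sub_sq_real x z
      have e3 := norm_sub_sq_real x m
      have := iy x
      nlinarith
    · rw [dS_neg hxm]
      have hm0 : m ≠ 0 := fun h => hxm (by rw [h]; exact seg_zero hS hx)
      have hmp : 0 < ‖m‖ := norm_pos_iff.2 hm0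
      have hxp : 0 ≤ ‖x‖ := norm_nonneg _
      have half : ∀ v : E2, v ∈ S → Seg S v m → Seg S x v →
          ‖x‖ * inner ℝ m v + ‖m‖ * inner ℝ x v ≤ 0 := by
        intro v hv hvm hxv
        obtain ⟨a, b, c, ha, hb, hc, h1, h⟩ := cone_tri hS hx hmS hxv.symm hvm hxm
        exact key1 hm0 hb ha hc (by linarith) (by rw [← h]; abel)
      have imm : inner ℝ m y + inner ℝ m z = 2 * ‖m‖ ^ 2 := by
        rw [← iy m, real_inner_self_eq_norm_sq]
      have cy := (abs_le.1 (abs_real_inner_le_norm m y)).2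
      have cz := (abs_le.1 (abs_real_inner_le_norm m z)).2
      -- define A_v := (d(x,v)^2 - |x|^2 - |v|^2)/2 >= |x| <m̂,v>
      have B : ∀ v : E2, v ∈ S → Seg S v m → 
          ‖m‖ * (‖x‖ ^ 2 + ‖v‖ ^ 2) + 2 * (‖x‖ * inner ℝ m v) ≤ ‖m‖ * dS S x v ^ 2 := by
        intro v hv hvm
        by_cases hxv : Seg S x v
        · have := half v hv hvm hxv
          rw [dS_pos hxv, norm_sub_sq_real]; nlinarith
        · rw [dS_neg hxv]
          have cv := (abs_le.1 (abs_real_inner_le_norm m v)).2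
          have := mul_le_mul_of_nonneg_left cv hxp
          nlinarith
      have By := B y hy hym
      have Bz := B z hz hzm
      have : ‖m‖ * (‖x‖ + ‖m‖) ^ 2 ≤
          ‖m‖ * (dS S x y ^ 2 / 2 + dS S x z ^ 2 / 2 - ‖y - z‖ ^ 2 / 4) := by
        have e : ‖m‖ * (‖x‖ + ‖m‖) ^ 2 = ‖m‖ * ‖x‖ ^ 2 + ‖x‖ * (2 * ‖m‖ ^ 2) + ‖m‖ * ‖m‖ ^ 2 := by
          ring
        rw [e, ← imm, par]
        linarith
      exact le_of_mul_le_mul_left this hmp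

lemma cone_CN {S : Set E2} {ε : ℝ} (hS : ConeNhd S ε) {y z : E2} (hy : y ∈ S) (hz : z ∈ S) :
    ∃ m ∈ S, dS S y m ≤ dS S y z / 2 ∧ dS S m z ≤ dS S y z / 2 ∧ ‖m‖ ≤ max ‖y‖ ‖z‖ ∧
      ∀ x ∈ S, dS S x m ^ 2 ≤ dS S x y ^ 2 / 2 + dS S x z ^ 2 / 2 - dS S y z ^ 2 / 4 := by
  by_cases hyz : Seg S y z
  · exact cone_CN_A hS hy hz hyz
  · rcases le_total ‖z‖ ‖y‖ with h | h
    · exact cone_CN_B hS hy hz hyz h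
    · obtain ⟨m, hm, h1, h2, h3, h4⟩ := cone_CN_B hS hz hy (fun hh => hyz hh.symm) h
      refine ⟨m, hm, ?_, ?_, ?_, ?_⟩
      · rw [dS_comm S y m, dS_comm S y z]; exact h2
      · rw [dS_comm S m z, dS_comm S y z]; exact h1
      · rwa [max_comm]
      · intro x hx
        rw [dS_comm S y z]; linarith [h4 x hx]

/-- lower bound: a path crossing must be long -/
lemma cone_cross {S : Set E2} {ε : ℝ} (hS : ConeNhd S ε) {x y : E2} (hx : x ∈ S) (hy : y ∈ S)
    (hxy : ¬ Seg S x y) (σ : unitInterval → E2) (hσ : Continuous σ) (h0 : σ 0 = x) (h1 : σ 1 = y)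
    (hσS : ∀ t, σ t ∈ S) : ∃ t, ‖x‖ + ‖y‖ ≤ ‖x - σ t‖ + ‖σ t - y‖ := by
  unfold Seg at hxy
  push Not at hxy
  obtain ⟨s, hs0, hs1, hw⟩ := hxy
  have hwε := cone_norm_lt hS hx hy hs0 hs1
  set w := (1 - s) • x + s • y with hwdef
  have hw0 : w ≠ 0 := fun h => hw (h ▸ hS.zero)
  have hs0' : 0 < s := by
    rcases eq_or_lt_of_le hs0 with h | h
    · exfalso; apply hw; rw [hwdef, ← h]; simpa using hx
    · exact h
  have hww : (1 - s) * det2 w x + s * det2 w y = 0 := by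
    rw [← det2_comb, ← hwdef]; simp [det2]; ring
  have hcont : Continuous fun t => det2 w (σ t) := by
    unfold det2; fun_prop
  have hex : ∃ t, det2 w (σ t) = 0 := by
    rcases le_total 0 (det2 w x) with h | h
    · have h2 : det2 w y ≤ 0 := by
        by_contra hc; push Not at hc
        nlinarith [mul_pos hs0' hc, mul_nonneg (sub_nonneg.2 hs1) h]
      exact mem_range_of_exists_le_of_exists_ge hcont ⟨1, by rwa [h1]⟩ ⟨0, by rwa [h0]⟩
    · have h2 : 0 ≤ det2 w y := by
        by_contra hc; push Not at hc
        nlinarith [mul_pos hs0' (neg_pos.2 hc), mul_nonneg (sub_nonneg.2 hs1) (neg_nonneg.2 h)]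
      exact mem_range_of_exists_le_of_exists_ge hcont ⟨0, by rwa [h0]⟩ ⟨1, by rwa [h1]⟩
  obtain ⟨t, ht⟩ := hex
  refine ⟨t, ?_⟩
  obtain ⟨l, hl⟩ := det2_zero hw0 ht
  have hl0 : l ≤ 0 := by
    by_contra hc
    push Not at hc
    apply hw
    have h3 : w = l⁻¹ • σ t := by
      rw [hl, smul_smul, inv_mul_cancel₀ hc.ne', one_smul]
    rw [h3]
    apply hS.smul _ (hσS t) _ (inv_nonneg.2 hc.le)
    rw [← h3]; exact hwε
  -- 0 = convex combination of w and l w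
  have hxyw : ‖x - w‖ + ‖w - y‖ = ‖x - y‖ := by
    have e1 : x - w = s • (x - y) := by rw [hwdef]; module
    have e2 : w - y = (1 - s) • (x - y) := by rw [hwdef]; module
    rw [e1, e2, norm_smul, norm_smul, Real.norm_of_nonneg hs0, Real.norm_of_nonneg (by linarith)]
    ring
  have h1l : 0 < 1 - l := by linarith
  have ex : (1 - l) • x = (x - σ t) + (-l) • (x - w) := by rw [hl]; module
  have ey : (1 - l) • y = -(σ t - y) + (-l) • (-(w - y)) := by rw [hl]; module
  have nx : (1 - l) * ‖x‖ ≤ ‖x - σ t‖ + (-l) * ‖x - w‖ := by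
    have := norm_add_le (x - σ t) ((-l) • (x - w))
    rwa [← ex, norm_smul, norm_smul, Real.norm_of_nonneg h1l.le,
      Real.norm_of_nonneg (neg_nonneg.2 hl0)] at this
  have ny : (1 - l) * ‖y‖ ≤ ‖σ t - y‖ + (-l) * ‖w - y‖ := by
    have := norm_add_le (-(σ t - y)) ((-l) • (-(w - y)))
    rwa [← ey, norm_smul, norm_smul, Real.norm_of_nonneg h1l.le,
      Real.norm_of_nonneg (neg_nonneg.2 hl0), norm_neg, norm_neg] at this
  have hle : ‖x - y‖ ≤ ‖x‖ + ‖y‖ := norm_sub_le _ _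
  have : (-l) * ‖x - y‖ ≤ (-l) * (‖x‖ + ‖y‖) := by
    apply mul_le_mul_of_nonneg_left hle; linarith
  nlinarith


end

section
open Filter Topology

lemma poly_far (p : E2) (T : Finset E2) (hp : p ∉ convexHull ℝ (T : Set E2)) :
    ∃ ε > 0, ∀ w ∈ convexHull ℝ (T : Set E2), ε ≤ dist w p := by
  have hc : IsClosed (convexHull ℝ (T : Set E2)) := (T.finite_toSet.isCompact_convexHull ℝ).isClosed
  obtain ⟨ε, h0, h⟩ := Metric.isOpen_iff.1 hc.isOpen_compl p hp
  refine ⟨ε, h0, fun w hw => ?_⟩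
  by_contra hcon
  push Not at hcon
  exact h (Metric.mem_ball.2 hcon) hw

lemma poly_conic (p : E2) (S : Finset E2) (hp : p ∈ convexHull ℝ (S : Set E2)) :
    ∃ ε > 0, ∀ u : E2, p + u ∈ convexHull ℝ (S : Set E2) → ∀ c : ℝ, 0 ≤ c → ‖c • u‖ < ε →
      p + c • u ∈ convexHull ℝ (S : Set E2) := by
  classical
  have hT : ∀ᶠ ε in 𝓝[>] (0 : ℝ), ∀ T ∈ S.powerset, p ∉ convexHull ℝ (T : Set E2) →
      ∀ w ∈ convexHull ℝ (T : Set E2), ε ≤ dist w p := by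
    rw [Filter.eventually_all_finset]
    intro T _
    by_cases hpT : p ∈ convexHull ℝ (T : Set E2)
    · exact Eventually.of_forall fun ε h => absurd hpT h
    · obtain ⟨ε, h0, h⟩ := poly_far p T hpT
      filter_upwards [Ioc_mem_nhdsGT h0] with e he _ w hw
      exact he.2.trans (h w hw)
  obtain ⟨ε, hε, hε0⟩ := (hT.and self_mem_nhdsWithin).exists
  refine ⟨ε, hε0, ?_⟩
  intro u hu c hc hcu
  have hconv := convex_convexHull ℝ (S : Set E2)
  have hcomp : IsCompact (convexHull ℝ (S : Set E2)) := S.finite_toSet.isCompact_convexHull ℝ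
  by_cases hu0 : u = 0
  · simpa [hu0] using hp
  have hup : 0 < ‖u‖ := norm_pos_iff.2 hu0
  -- the set of admissible scalings
  set K : Set ℝ := {c | 0 ≤ c ∧ p + c • u ∈ convexHull ℝ (S : Set E2)} with hK
  have hKclosed : IsClosed K := by
    apply IsClosed.inter isClosed_Ici
    exact hcomp.isClosed.preimage (by fun_prop)
  obtain ⟨R, hR⟩ := hcomp.isBounded.subset_closedBall p
  have hKb : K ⊆ Set.Icc 0 (R / ‖u‖) := by
    intro c hc
    refine ⟨hc.1, ?_⟩
    have := hR hc.2
    rw [Metric.mem_closedBall, dist_eq_norm, add_sub_cancel_left, norm_smul,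
      Real.norm_of_nonneg hc.1] at this
    rwa [le_div_iff₀ hup]
  have hKc : IsCompact K := isCompact_Icc.of_isClosed_subset hKclosed hKb
  obtain ⟨M, hM, hMax⟩ := hKc.exists_isGreatest ⟨1, zero_le_one, by simpa using hu⟩
  have hM1 : 1 ≤ M := hMax ⟨zero_le_one, by simpa using hu⟩
  have hM0 : 0 < M := by linarith
  have hMw := hM.2
  rw [Finset.mem_convexHull'] at hMw
  obtain ⟨a, ha0, ha1, haw⟩ := hMw
  set T := S.filter (fun v => 0 < a v) with hTdef
  have haz : ∀ v ∈ S, v ∉ T → a v = 0 := by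
    intro v hv hvT
    have : ¬ 0 < a v := fun h => hvT (Finset.mem_filter.2 ⟨hv, h⟩)
    exact le_antisymm (not_lt.1 this) (ha0 v hv)
  have hTS : T ⊆ S := Finset.filter_subset _ _
  have hT1 : ∑ v ∈ T, a v = 1 := by rw [Finset.sum_subset hTS haz, ha1]
  have hTw : ∑ v ∈ T, a v • v = p + M • u := by
    rw [Finset.sum_subset hTS, haw]
    intro v hv hvT; rw [haz v hv hvT, zero_smul]
  have hwT : p + M • u ∈ convexHull ℝ (T : Set E2) := by
    rw [Finset.mem_convexHull']
    exact ⟨a, fun v hv => ha0 v (hTS hv), hT1, hTw⟩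
  have hpT : p ∉ convexHull ℝ (T : Set E2) := by
    intro hpT
    rw [Finset.mem_convexHull'] at hpT
    obtain ⟨b, hb0, hb1, hbp⟩ := hpT
    have hev : ∀ᶠ δ in 𝓝[>] (0 : ℝ), ∀ v ∈ T, δ ≤ a v := by
      rw [Filter.eventually_all_finset]
      intro v hv
      have : 0 < a v := (Finset.mem_filter.1 hv).2
      filter_upwards [Ioc_mem_nhdsGT this] with e he using he.2
    obtain ⟨δ, hδ, hδ0⟩ := (hev.and self_mem_nhdsWithin).exists
    have hδ0 : 0 < δ := hδ0
    have hin : p + ((1 + δ) * M) • u ∈ convexHull ℝ (T : Set E2) := by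
      rw [Finset.mem_convexHull']
      refine ⟨fun v => (1 + δ) * a v - δ * b v, ?_, ?_, ?_⟩
      · intro v hv
        have hb : b v ≤ 1 := by
          rw [← hb1]; exact Finset.single_le_sum (f := b) (fun i hi => hb0 i hi) hv
        have h1 := hδ v hv
        have h2 := mul_le_mul_of_nonneg_left hb hδ0.le
        have h3 := mul_nonneg hδ0.le (ha0 v (hTS hv))
        linarith
      · rw [Finset.sum_sub_distrib, ← Finset.mul_sum, ← Finset.mul_sum, hT1, hb1]; ring
      · simp_rw [sub_smul, mul_smul]
        rw [Finset.sum_sub_distrib, ← Finset.smul_sum, ← Finset.smul_sum, hTw, hbp]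
        module
    have := hMax (show (1 + δ) * M ∈ K from ⟨by positivity,
      convexHull_mono (by exact_mod_cast hTS) hin⟩)
    nlinarith
  have hfar := hε T (Finset.mem_powerset.2 hTS) hpT _ hwT
  rw [dist_eq_norm, add_sub_cancel_left, norm_smul, Real.norm_of_nonneg hM0.le] at hfar
  rw [norm_smul, Real.norm_of_nonneg hc] at hcu
  have hcM : c < M := by
    have : c * ‖u‖ < M * ‖u‖ := by linarith
    exact lt_of_mul_lt_mul_right this hup.le
  have := hconv hp hM.2 (show 0 ≤ 1 - c / M by rw [sub_nonneg, div_le_one hM0]; exact hcM.le)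
    (show 0 ≤ c / M by positivity) (by ring)
  convert this using 1
  have hcm : c • u = (c / M) • M • u := by rw [smul_smul, div_mul_cancel₀ _ hM0.ne']
  rw [hcm]; module

def Sp (X : Set E2) (p : E2) (ε : ℝ) : Set E2 := {u | p + u ∈ X ∧ ‖u‖ < ε}

lemma conic_nhd {X : Set E2}
    (hpoly : ∃ (n : ℕ) (P : Fin n → Finset E2), X = ⋃ i, convexHull ℝ (↑(P i) : Set E2))
    {p : E2} (hp : p ∈ X) : ∃ ε > 0, ConeNhd (Sp X p ε) ε := by
  obtain ⟨n, P, hX⟩ := hpoly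
  have hev : ∀ᶠ ε in 𝓝[>] (0 : ℝ), ∀ i : Fin n, ∀ u : E2, ‖u‖ < ε →
      p + u ∈ convexHull ℝ (P i : Set E2) → ∀ c : ℝ, 0 ≤ c → ‖c • u‖ < ε →
      p + c • u ∈ convexHull ℝ (P i : Set E2) := by
    rw [Filter.eventually_all]
    intro i
    by_cases hi : p ∈ convexHull ℝ (P i : Set E2)
    · obtain ⟨ε, h0, h⟩ := poly_conic p (P i) hi
      filter_upwards [Ioc_mem_nhdsGT h0] with e he u _ hu c hc hcu
      exact h u hu c hc (hcu.trans_le he.2)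
    · obtain ⟨ε, h0, h⟩ := poly_far p (P i) hi
      filter_upwards [Ioc_mem_nhdsGT h0] with e he u hue hu
      have := h _ hu
      rw [dist_eq_norm, add_sub_cancel_left] at this
      linarith [he.2]
  obtain ⟨ε, hε, hε0⟩ := (hev.and self_mem_nhdsWithin).exists
  have hε0 : 0 < ε := hε0
  refine ⟨ε, hε0, ⟨by simpa using hp, by simpa using hε0⟩, fun u hu => hu.2, ?_⟩
  intro u hu c hc hcu
  refine ⟨?_, hcu⟩
  have h1 := hu.1
  rw [hX, Set.mem_iUnion] at h1 ⊢
  obtain ⟨i, hi⟩ := h1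
  exact ⟨i, hε i u hu.2 hi c hc hcu⟩

/-! ### cost -/

variable {X : Set E2}

lemma edist_le_cost {x y : X} (σ : Path x y) (s t : unitInterval) :
    edist (σ s : E2) (σ t) ≤ cost σ :=
  eVariationOn.edist_le (fun t => (σ t : E2)) (Set.mem_univ s) (Set.mem_univ t)

lemma cost_split {x y : X} (σ : Path x y) (t : unitInterval) :
    cost σ = eVariationOn (fun t => (σ t : E2)) (Set.Iic t)
      + eVariationOn (fun t => (σ t : E2)) (Set.Ici t) := by
  unfold cost
  rw [← Set.Iic_union_Ici (a := t)]
  exact eVariationOn.union _ isGreatest_Iic isLeast_Ici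

lemma edist_add_le_cost {x y : X} (σ : Path x y) (t : unitInterval) :
    edist (x : E2) (σ t) + edist (σ t : E2) y ≤ cost σ := by
  rw [cost_split σ t]
  apply add_le_add
  · have := eVariationOn.edist_le (fun t => (σ t : E2)) (s := Set.Iic t) (x := 0) (y := t)
      (Set.mem_Iic.2 unitInterval.nonneg') (Set.mem_Iic.2 le_rfl)
    simpa using this
  · have := eVariationOn.edist_le (fun t => (σ t : E2)) (s := Set.Ici t) (x := t) (y := 1)
      (Set.mem_Ici.2 le_rfl) (Set.mem_Ici.2 unitInterval.le_one')
    simpa using this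

lemma cost_symm {x y : X} (σ : Path x y) : cost σ.symm = cost σ := by
  unfold cost
  have := eVariationOn.comp_eq_of_antitoneOn (fun t => (σ t : E2)) (t := Set.univ)
    (unitInterval.symm) (fun a _ b _ h => unitInterval.symm_le_symm.2 h)
  rw [Set.image_univ_of_surjective (fun t => ⟨unitInterval.symm t, unitInterval.symm_symm t⟩)] at this
  exact this

lemma cost_cast {x y x' y' : X} (σ : Path x y) (hx : x' = x) (hy : y' = y) :
    cost (σ.cast hx hy) = cost σ := rfl

lemma half_mem : (1 / 2 : ℝ) ∈ unitInterval := ⟨by norm_num, by norm_num⟩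

def uhalf : unitInterval := ⟨1 / 2, half_mem⟩

lemma cost_trans {x y z : X} (σ : Path x y) (τ : Path y z) :
    cost (σ.trans τ) = cost σ + cost τ := by
  rw [cost_split _ uhalf]
  congr 1
  · have h := eVariationOn.comp_eq_of_monotoneOn (fun t => (σ t : E2)) (t := Set.Iic uhalf)
      (fun t => Set.projIcc (0 : ℝ) 1 zero_le_one (2 * t))
      (fun a _ b _ h => Set.monotone_projIcc _ (by have : (a : ℝ) ≤ b := h; linarith))
    have him : (fun t : unitInterval => Set.projIcc (0 : ℝ) 1 zero_le_one (2 * t)) ''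
        Set.Iic uhalf = Set.univ := by
      rw [Set.eq_univ_iff_forall]
      intro s
      have h1 := s.2.1
      have h2 := s.2.2
      refine ⟨⟨s / 2, by constructor <;> linarith⟩, ?_, ?_⟩
      · show (s : ℝ) / 2 ≤ 1 / 2
        linarith
      · simp only
        have : 2 * ((s : ℝ) / 2) = s := by ring
        rw [this, Set.projIcc_val]
    rw [him] at h
    unfold cost
    rw [← h]
    apply eVariationOn.congr
    intro t ht
    have ht' : (t : ℝ) ≤ 1 / 2 := ht
    simp only [Function.comp]
    rw [Path.trans_apply, dif_pos ht']
    congr 2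
    apply Subtype.ext
    rw [Set.projIcc_of_mem zero_le_one ((unitInterval.mul_pos_mem_iff zero_lt_two).2 ⟨t.2.1, ht'⟩)]
  · have h := eVariationOn.comp_eq_of_monotoneOn (fun t => (τ t : E2)) (t := Set.Ici uhalf)
      (fun t => Set.projIcc (0 : ℝ) 1 zero_le_one (2 * t - 1))
      (fun a _ b _ h => Set.monotone_projIcc _ (by have : (a : ℝ) ≤ b := h; linarith))
    have him : (fun t : unitInterval => Set.projIcc (0 : ℝ) 1 zero_le_one (2 * t - 1)) ''
        Set.Ici uhalf = Set.univ := by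
      rw [Set.eq_univ_iff_forall]
      intro s
      have h1 := s.2.1
      have h2 := s.2.2
      refine ⟨⟨(s + 1) / 2, by constructor <;> linarith⟩, ?_, ?_⟩
      · show (1 : ℝ) / 2 ≤ (s + 1) / 2
        linarith
      · simp only
        have : 2 * (((s : ℝ) + 1) / 2) - 1 = s := by ring
        rw [this, Set.projIcc_val]
    rw [him] at h
    unfold cost
    rw [← h]
    apply eVariationOn.congr
    intro t ht
    have ht' : 1 / 2 ≤ (t : ℝ) := ht
    simp only [Function.comp]
    rw [Path.trans_apply]
    split_ifs with h3
    · have h4 : (t : ℝ) = 1 / 2 := le_antisymm h3 ht'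
      have e1 : Set.projIcc (0 : ℝ) 1 zero_le_one (2 * (t : ℝ) - 1) = 0 := by
        rw [h4]; norm_num
      rw [e1]
      have e2 : (⟨2 * (t : ℝ), (unitInterval.mul_pos_mem_iff zero_lt_two).2 ⟨t.2.1, h3⟩⟩ :
        unitInterval) = 1 := Subtype.ext (by show 2 * (t : ℝ) = 1; rw [h4]; norm_num)
      simp [e2]
    · congr 2
      apply Subtype.ext
      rw [Set.projIcc_of_mem zero_le_one (unitInterval.two_mul_sub_one_mem_iff.2 ⟨ht', t.2.2⟩)]

/-- Lipschitz paths have bounded cost -/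
lemma evar_le_of_lip {f : unitInterval → E2} {L : ℝ} (hL : 0 ≤ L) {s : Set unitInterval}
    {a b : unitInterval} (hs : s ⊆ Set.Icc a b) (hab : a ≤ b)
    (hf : ∀ u v : unitInterval, dist (f u) (f v) ≤ L * |(u : ℝ) - v|) :
    eVariationOn f s ≤ ENNReal.ofReal (L * ((b : ℝ) - a)) := by
  have h1 : LipschitzOnWith (Real.toNNReal L) f s := by
    apply LipschitzOnWith.of_dist_le_mul
    intro u _ v _
    rw [Real.coe_toNNReal _ hL, Subtype.dist_eq, Real.dist_eq]; exact hf u v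
  apply iSup_le
  rintro ⟨n, u, hu, hus⟩
  have : ∀ i, edist (f (u (i + 1))) (f (u i)) ≤
      ENNReal.ofReal (L * (u (i + 1) : ℝ) - L * u i) := by
    intro i
    rw [edist_dist]
    apply ENNReal.ofReal_le_ofReal
    refine (hf _ _).trans ?_
    have h2 : (u i : ℝ) ≤ u (i + 1) := hu (Nat.le_succ i)
    rw [abs_of_nonneg (by linarith)]
    linarith
  refine (Finset.sum_le_sum fun i _ => this i).trans ?_
  rw [← ENNReal.ofReal_sum_of_nonneg]
  · apply ENNReal.ofReal_le_ofReal
    rw [Finset.sum_range_sub (fun i => L * (u i : ℝ))]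
    have h3 : (u n : ℝ) ≤ b := (hs (hus n)).2
    have h4 : (a : ℝ) ≤ u 0 := (hs (hus 0)).1
    nlinarith
  · intro i _
    have h2 : (u i : ℝ) ≤ u (i + 1) := hu (Nat.le_succ i)
    nlinarith

lemma cost_line {x y : E2} (hx : x ∈ X) (hy : y ∈ X) (hs : segment ℝ x y ⊆ X) :
    cost (linePath hx hy hs) ≤ ENNReal.ofReal ‖x - y‖ := by
  have := evar_le_of_lip (f := fun t => (linePath hx hy hs t : E2)) (norm_nonneg (x - y))
    (s := Set.univ) (a := 0) (b := 1) (fun t _ => ⟨t.2.1, t.2.2⟩) zero_le_one (by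
      intro u v
      show dist ((1 - (u : ℝ)) • x + (u : ℝ) • y) ((1 - (v : ℝ)) • x + (v : ℝ) • y) ≤ _
      rw [dist_eq_norm]
      have : ((1 - (u : ℝ)) • x + (u : ℝ) • y) - ((1 - (v : ℝ)) • x + (v : ℝ) • y)
        = (v - u : ℝ) • (x - y) := by module
      rw [this, norm_smul, Real.norm_eq_abs, abs_sub_comm, mul_comm])
  simpa [cost] using this

def dX (x y : X) : ENNReal := ⨅ σ : Path x y, cost σ

lemma dX_le_cost {x y : X} (σ : Path x y) : dX x y ≤ cost σ := iInf_le _ σ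

lemma edist_le_dX (x y : X) : edist (x : E2) y ≤ dX x y := by
  apply le_iInf
  intro σ
  have := edist_le_cost σ 0 1
  simpa using this

lemma dX_comm (x y : X) : dX x y = dX y x := by
  apply le_antisymm
  · apply le_iInf; intro σ; rw [← cost_symm]; exact dX_le_cost _
  · apply le_iInf; intro σ; rw [← cost_symm]; exact dX_le_cost _

lemma dX_self (x : X) : dX x x = 0 := by
  apply le_antisymm _ zero_le
  refine (dX_le_cost (Path.refl x)).trans ?_
  unfold cost
  rw [eVariationOn.constant_on]
  rintro _ ⟨a, _, rfl⟩ _ ⟨b, _, rfl⟩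
  rfl

lemma dX_triangle (x y z : X) : dX x z ≤ dX x y + dX y z := by
  unfold dX
  rw [ENNReal.iInf_add]
  apply le_iInf; intro σ
  rw [ENNReal.add_iInf]
  apply le_iInf; intro τ
  rw [← cost_trans]
  exact iInf_le _ _

lemma seg_sub {p : E2} {ε : ℝ} {x y : E2} (h : Seg (Sp X p ε) (x - p) (y - p)) :
    segment ℝ x y ⊆ X := by
  rw [segment_eq_image]
  rintro _ ⟨r, hr, rfl⟩
  have := (h r hr.1 hr.2).1
  convert this using 1
  module

lemma local_geo {p : E2} {ε : ℝ} (hS : ConeNhd (Sp X p ε) ε) (x y : X)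
    (hx : ‖(x : E2) - p‖ < ε) (hy : ‖(y : E2) - p‖ < ε) :
    ∃ σ : Path x y, cost σ ≤ ENNReal.ofReal (dS (Sp X p ε) (x - p) (y - p)) := by
  have hxS : (x : E2) - p ∈ Sp X p ε := ⟨by simp, hx⟩
  have hyS : (y : E2) - p ∈ Sp X p ε := ⟨by simp, hy⟩
  by_cases h : Seg (Sp X p ε) (x - p) (y - p)
  · refine ⟨linePath x.2 y.2 (seg_sub h), ?_⟩
    rw [dS_pos h, sub_sub_sub_cancel_right]
    exact cost_line _ _ _
  · have hpX : p ∈ X := by simpa using hS.zero.1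
    have h1 : segment ℝ (x : E2) p ⊆ X :=
      seg_sub (p := p) (ε := ε) (x := (x : E2)) (y := p) (by rw [sub_self]; exact seg_zero hS hxS)
    have h2 : segment ℝ p (y : E2) ⊆ X := by
      rw [segment_symm]; exact seg_sub (p := p) (ε := ε) (x := (y : E2)) (y := p) (by rw [sub_self]; exact seg_zero hS hyS)
    refine ⟨(linePath x.2 hpX h1).trans (linePath hpX y.2 h2), ?_⟩
    rw [cost_trans, dS_neg h, ENNReal.ofReal_add (norm_nonneg _) (norm_nonneg _)]
    refine add_le_add (cost_line _ _ _) ?_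
    rw [norm_sub_rev]
    exact cost_line _ _ _

lemma local_lower {p : E2} {ε : ℝ} (hS : ConeNhd (Sp X p ε) ε) (x y : X)
    (hx : ‖(x : E2) - p‖ < ε / 4) (hy : ‖(y : E2) - p‖ < ε / 4) (σ : Path x y) :
    ENNReal.ofReal (dS (Sp X p ε) (x - p) (y - p)) ≤ cost σ := by
  have hε : 0 < ε := by linarith [norm_nonneg ((x : E2) - p)]
  have hxS : (x : E2) - p ∈ Sp X p ε := ⟨by simp, by linarith⟩
  have hyS : (y : E2) - p ∈ Sp X p ε := ⟨by simp, by linarith⟩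
  have fin : ∀ t, dS (Sp X p ε) (x - p) (y - p) ≤ ‖(x : E2) - σ t‖ + ‖(σ t : E2) - y‖ →
      ENNReal.ofReal (dS (Sp X p ε) (x - p) (y - p)) ≤ cost σ := by
    intro t ht
    refine le_trans ?_ (edist_add_le_cost σ t)
    rw [edist_dist, edist_dist, ← ENNReal.ofReal_add dist_nonneg dist_nonneg, dist_eq_norm,
      dist_eq_norm]
    exact ENNReal.ofReal_le_ofReal ht
  by_cases hin : ∀ t, ‖(σ t : E2) - p‖ < ε
  · by_cases h : Seg (Sp X p ε) (x - p) (y - p)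
    · apply fin 0
      rw [dS_pos h]; simp
    · obtain ⟨t, ht⟩ := cone_cross hS hxS hyS h (fun t => (σ t : E2) - p) (by fun_prop)
        (by simp) (by simp) (fun t => ⟨by simp, hin t⟩)
      apply fin t
      rw [dS_neg h]
      simpa using ht
  · push Not at hin
    obtain ⟨t, ht⟩ := hin
    apply fin t
    refine (dS_le _ _ _).trans ?_
    have h1 : ‖(σ t : E2) - p‖ ≤ ‖(x : E2) - σ t‖ + ‖(x : E2) - p‖ := by
      have := norm_sub_le ((x : E2) - p) ((x : E2) - σ t)
      rw [sub_sub_sub_cancel_left] at this; linarith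
    have h2 : ‖(σ t : E2) - p‖ ≤ ‖(σ t : E2) - y‖ + ‖(y : E2) - p‖ := by
      have := norm_add_le ((σ t : E2) - y) ((y : E2) - p)
      rwa [sub_add_sub_cancel] at this
    linarith

lemma local_dX {p : E2} {ε : ℝ} (hS : ConeNhd (Sp X p ε) ε) (x y : X)
    (hx : ‖(x : E2) - p‖ < ε / 4) (hy : ‖(y : E2) - p‖ < ε / 4) :
    dX x y = ENNReal.ofReal (dS (Sp X p ε) (x - p) (y - p)) := by
  have hε : 0 < ε := by linarith [norm_nonneg ((x : E2) - p)]
  apply le_antisymm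
  · obtain ⟨σ, h⟩ := local_geo hS x y (by linarith) (by linarith)
    exact (dX_le_cost σ).trans h
  · exact le_iInf fun σ => local_lower hS x y hx hy σ


end

section
variable {X : Set E2}

def LocR (X : Set E2) (r : ℝ) : Prop :=
  0 < r ∧ ∀ x : X, ∃ p ∈ X, ∃ ε : ℝ, ConeNhd (Sp X p ε) ε ∧
    ∀ y : X, dist (y : E2) x < r → ‖(y : E2) - p‖ < ε / 4

lemma exists_LocR (hcomp : IsCompact X)
    (hpoly : ∃ (n : ℕ) (P : Fin n → Finset E2), X = ⋃ i, convexHull ℝ (↑(P i) : Set E2)) :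
    ∃ r, LocR X r := by
  have h : ∀ p : X, ∃ ε > 0, ConeNhd (Sp X p ε) ε := fun p => conic_nhd hpoly p.2
  choose ε h0 hε using h
  obtain ⟨r, hr, hb⟩ := lebesgue_number_lemma_of_metric (c := fun p : X => Metric.ball (p : E2) (ε p / 4))
    hcomp (fun i => Metric.isOpen_ball) (fun x hx => Set.mem_iUnion.2 ⟨⟨x, hx⟩,
      Metric.mem_ball_self (by have := h0 ⟨x, hx⟩; linarith)⟩)
  refine ⟨r, hr, fun x => ?_⟩
  obtain ⟨p, hp⟩ := hb x x.2
  refine ⟨p, p.2, ε p, hε p, fun y hy => ?_⟩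
  have := hp (Metric.mem_ball.2 hy)
  rwa [Metric.mem_ball, dist_eq_norm] at this

lemma dist_lt_of_dX {x y : X} {r : ℝ} (h : dX x y < ENNReal.ofReal r) : dist (x : E2) y < r := by
  have := (edist_le_dX x y).trans_lt h
  rw [edist_dist] at this
  exact (ENNReal.ofReal_lt_ofReal_iff_of_nonneg dist_nonneg).1 this

lemma dX_eq_zero {x y : X} (h : dX x y = 0) : x = y := by
  have := edist_le_dX x y
  rw [h] at this
  exact Subtype.ext (edist_eq_zero.1 (le_antisymm this zero_le))

lemma geo_exists {r : ℝ} (hr : LocR X r) {x y : X} (h : dist (x : E2) y < r) :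
    (∃ σ : Path x y, cost σ = dX x y) ∧ dX x y ≠ ⊤ := by
  obtain ⟨p, hp, ε, hS, hb⟩ := hr.2 x
  have hx := hb x (by simpa using hr.1)
  have hy := hb y (by rwa [dist_comm])
  have hε : 0 < ε := by linarith [norm_nonneg ((x : E2) - p)]
  have e := local_dX hS x y hx hy
  refine ⟨?_, by rw [e]; exact ENNReal.ofReal_ne_top⟩
  obtain ⟨σ, hσ⟩ := local_geo hS x y (by linarith) (by linarith)
  exact ⟨σ, le_antisymm (by rw [e]; exact hσ) (dX_le_cost σ)⟩

/-- uniform control of the intrinsic distance -/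
lemma dX_uniform (hcomp : IsCompact X)
    (hpoly : ∃ (n : ℕ) (P : Fin n → Finset E2), X = ⋃ i, convexHull ℝ (↑(P i) : Set E2))
    {η : ℝ} (hη : 0 < η) : ∃ δ > 0, ∀ x y : X, dist (x : E2) y < δ → dX x y < ENNReal.ofReal η := by
  have h : ∀ p : X, ∃ ε > 0, ConeNhd (Sp X p ε) ε := fun p => conic_nhd hpoly p.2
  choose ε h0 hε using h
  obtain ⟨δ, hδ, hb⟩ := lebesgue_number_lemma_of_metric
    (c := fun p : X => Metric.ball (p : E2) (min (ε p / 4) (η / 2)))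
    hcomp (fun i => Metric.isOpen_ball) (fun x hx => Set.mem_iUnion.2 ⟨⟨x, hx⟩,
      Metric.mem_ball_self (by have := h0 ⟨x, hx⟩; apply lt_min <;> linarith)⟩)
  refine ⟨δ, hδ, fun x y hxy => ?_⟩
  obtain ⟨p, hp⟩ := hb x x.2
  have key : ∀ z : X, dist (z : E2) x < δ → dX p z < ENNReal.ofReal (η / 2) := by
    intro z hz
    have h1 := hp (Metric.mem_ball.2 hz)
    rw [Metric.mem_ball, dist_eq_norm] at h1
    have h2 := lt_min_iff.1 h1
    have := h0 p
    rw [local_dX (hε p) p z (by simpa using h0 p) h2.1, sub_self]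
    refine (ENNReal.ofReal_lt_ofReal_iff (by linarith)).2 ?_
    refine (dS_le _ _ _).trans_lt ?_
    rw [norm_zero, zero_add]; exact h2.2
  have h1 := key x (by simpa using hδ)
  have h2 := key y (by rwa [dist_comm])
  calc dX x y ≤ dX x p + dX p y := dX_triangle _ _ _
    _ < ENNReal.ofReal (η / 2) + ENNReal.ofReal (η / 2) := by
      rw [dX_comm x p]; exact ENNReal.add_lt_add h1 h2
    _ = ENNReal.ofReal η := by
      rw [← ENNReal.ofReal_add (by linarith) (by linarith)]; congr 1; ring

/-- small loops are contractible -/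
lemma small_homotopic {r : ℝ} (hr : LocR X r) {x y : X} (σ τ : Path x y)
    (hσ : ∀ t, dist (σ t : E2) x < r) (hτ : ∀ t, dist (τ t : E2) x < r) : σ.Homotopic τ := by
  obtain ⟨p, hp, ε, hS, hb⟩ := hr.2 x
  set U : Set E2 := {y | y ∈ X ∧ ‖y - p‖ < ε / 4} with hU
  have hε : 0 < ε := by
    have := hb x (by simpa using hr.1)
    linarith [norm_nonneg ((x : E2) - p)]
  have hst : StarConvex ℝ p U := by
    have hpU : p ∈ U := ⟨hp, by simpa using hε⟩
    rw [starConvex_iff_forall_pos hpU]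
    rintro y ⟨hy, hyp⟩ a b ha hb hab
    have e : a • p + b • y = p + b • (y - p) := by
      rw [← eq_sub_iff_add_eq] at hab; rw [hab]; module
    have hn : ‖b • (y - p)‖ < ε / 4 := by
      rw [norm_smul, Real.norm_of_nonneg hb.le]
      have : b ≤ 1 := by linarith
      nlinarith [norm_nonneg (y - p)]
    rw [e]
    refine ⟨?_, by simpa using hn⟩
    have := hS.smul (y - p) ⟨by simpa using hy, by linarith⟩ b hb.le (by linarith)
    exact this.1
  have : ContractibleSpace U := hst.contractibleSpace ⟨p, hp, by simpa using hε⟩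
  have hx : (x : E2) ∈ U := ⟨x.2, hb x (by simpa using hr.1)⟩
  have hy : (y : E2) ∈ U := ⟨y.2, hb y (by simpa using hσ 1)⟩
  let σ' : Path (⟨x, hx⟩ : U) ⟨y, hy⟩ :=
    { toFun := fun t => ⟨σ t, (σ t).2, hb _ (hσ t)⟩
      continuous_toFun := by fun_prop
      source' := by simp
      target' := by simp }
  let τ' : Path (⟨x, hx⟩ : U) ⟨y, hy⟩ :=
    { toFun := fun t => ⟨τ t, (τ t).2, hb _ (hτ t)⟩
      continuous_toFun := by fun_prop
      source' := by simp
      target' := by simp }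
  have h := SimplyConnectedSpace.paths_homotopic σ' τ'
  let f : C(U, X) := ⟨fun u => ⟨u, u.2.1⟩, by fun_prop⟩
  exact h.map f

lemma dist_lt_of_cost {x y : X} {r : ℝ} (σ : Path x y) (h : cost σ < ENNReal.ofReal r)
    (t : unitInterval) : dist (σ t : E2) x < r := by
  have := (edist_le_cost σ t 0).trans_lt h
  rw [edist_dist, Path.source] at this
  exact (ENNReal.ofReal_lt_ofReal_iff_of_nonneg dist_nonneg).1 this

lemma small_homotopic' {r : ℝ} (hr : LocR X r) {x y : X} (σ τ : Path x y)
    (hσ : cost σ < ENNReal.ofReal r) (hτ : cost τ < ENNReal.ofReal r) : σ.Homotopic τ :=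
  small_homotopic hr σ τ (dist_lt_of_cost σ hσ) (dist_lt_of_cost τ hτ)

def IsMid (m y z : X) : Prop := dX y m ≤ dX y z / 2 ∧ dX m z ≤ dX y z / 2

lemma IsMid.symm {m y z : X} (h : IsMid m y z) : IsMid m z y := by
  refine ⟨?_, ?_⟩
  · rw [dX_comm z m, dX_comm z y]; exact h.2
  · rw [dX_comm m y, dX_comm z y]; exact h.1

def dr (x y : X) : ℝ := (dX x y).toReal

lemma dr_comm (x y : X) : dr x y = dr y x := by unfold dr; rw [dX_comm]

lemma half_lt {a : ENNReal} {r : ℝ} (h : a < ENNReal.ofReal r) : a / 2 < ENNReal.ofReal r :=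
  ENNReal.half_le_self.trans_lt h

lemma ofReal_half (a : ℝ) : ENNReal.ofReal a / 2 = ENNReal.ofReal (a / 2) := by
  rw [ENNReal.ofReal_div_of_pos two_pos]; simp

lemma mid_CN0 {r : ℝ} (hr : LocR X r) {y z : X} (h : dX y z < ENNReal.ofReal r) :
    ∃ m, IsMid m y z ∧ ∀ x : X, dX y x < ENNReal.ofReal r →
      dr x m ^ 2 ≤ dr x y ^ 2 / 2 + dr x z ^ 2 / 2 - dr y z ^ 2 / 4 := by
  obtain ⟨p, hp, ε, hS, hb⟩ := hr.2 y
  have hb' : ∀ x : X, dX y x < ENNReal.ofReal r → ‖(x : E2) - p‖ < ε / 4 := fun x hx =>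
    hb x (by rw [dist_comm]; exact dist_lt_of_dX hx)
  have hy := hb y (by simpa using hr.1)
  have hz := hb' z h
  have hε : 0 < ε := by linarith [norm_nonneg ((y : E2) - p)]
  have mem : ∀ x : X, ‖(x : E2) - p‖ < ε / 4 → (x : E2) - p ∈ Sp X p ε := fun x hx =>
    ⟨by simp, by linarith⟩
  obtain ⟨m', hm', h1, h2, h3, h4⟩ := cone_CN hS (mem y hy) (mem z hz)
  set m : X := ⟨p + m', hm'.1⟩
  have em : (m : E2) - p = m' := by simp [m]
  have hm : ‖(m : E2) - p‖ < ε / 4 := by rw [em]; exact h3.trans_lt (max_lt hy hz)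
  rw [← em] at h1 h2 h4
  have nn : ∀ a b : E2, 0 ≤ dS (Sp X p ε) a b := fun a b => (norm_nonneg _).trans (le_dS _ a b)
  have edr : ∀ a b : X, ‖(a : E2) - p‖ < ε / 4 → ‖(b : E2) - p‖ < ε / 4 →
      dr a b = dS (Sp X p ε) (a - p) (b - p) := fun a b ha hb => by
    unfold dr; rw [local_dX hS a b ha hb, ENNReal.toReal_ofReal (nn _ _)]
  refine ⟨m, ⟨?_, ?_⟩, fun x hx => ?_⟩
  · rw [local_dX hS y m hy hm, local_dX hS y z hy hz, ofReal_half]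
    exact ENNReal.ofReal_le_ofReal h1
  · rw [local_dX hS m z hm hz, local_dX hS y z hy hz, ofReal_half]
    exact ENNReal.ofReal_le_ofReal h2
  · have hx' := hb' x hx
    rw [edr x m hx' hm, edr x y hx' hy, edr x z hx' hz, edr y z hy hz]
    exact h4 _ (mem x hx')

lemma dr_half {m y z : X} {r : ℝ} (h : dX y z < ENNReal.ofReal r) (hm : dX y m ≤ dX y z / 2) :
    dr y m ≤ dr y z / 2 := by
  unfold dr
  have := ENNReal.toReal_mono (half_lt h).ne_top hm
  rwa [ENNReal.toReal_div] at this

lemma mid_unique0 {r : ℝ} (hr : LocR X r) {y z m m' : X} (h : dX y z < ENNReal.ofReal r)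
    (hm : IsMid m y z)
    (hCN : dr m m' ^ 2 ≤ dr m y ^ 2 / 2 + dr m z ^ 2 / 2 - dr y z ^ 2 / 4) (hm' : IsMid m' y z) :
    m = m' := by
  have h1 := dr_half h hm.1
  have h2 := dr_half (m := m) (y := z) (z := y) (by rwa [dX_comm]) (hm.symm.1)
  have h0 : ∀ a b : X, 0 ≤ dr a b := fun a b => ENNReal.toReal_nonneg
  rw [dr_comm m y, dr_comm m z] at hCN
  rw [dr_comm z y] at h2
  have h3 : dr m m' = 0 := by
    have := h0 m m'; have := h0 y m; have := h0 z m; have := h0 y z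
    nlinarith
  unfold dr at h3
  rcases (ENNReal.toReal_eq_zero_iff _).1 h3 with h4 | h4
  · exact dX_eq_zero h4
  · exfalso
    have : dX m m' ≤ dX m y + dX y m' := dX_triangle _ _ _
    rw [h4, dX_comm m y] at this
    have h5 : dX y m < ⊤ := (hm.1.trans_lt (half_lt h)).trans ENNReal.ofReal_lt_top
    have h6 : dX y m' < ⊤ := (hm'.1.trans_lt (half_lt h)).trans ENNReal.ofReal_lt_top
    exact absurd this (not_le.2 (ENNReal.add_lt_top.2 ⟨h5, h6⟩))

lemma mid_exists {r : ℝ} (hr : LocR X r) {y z : X} (h : dX y z < ENNReal.ofReal r) :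
    ∃ m, IsMid m y z := let ⟨m, hm, _⟩ := mid_CN0 hr h; ⟨m, hm⟩

lemma mid_unique {r : ℝ} (hr : LocR X r) {y z m m' : X} (h : dX y z < ENNReal.ofReal r)
    (hm : IsMid m y z) (hm' : IsMid m' y z) : m = m' := by
  obtain ⟨n, hn, hC⟩ := mid_CN0 hr h
  rw [mid_unique0 hr h hm (hC m (hm.1.trans_lt (half_lt h))) hn,
    mid_unique0 hr h hm' (hC m' (hm'.1.trans_lt (half_lt h))) hn]

lemma mid_CN {r : ℝ} (hr : LocR X r) {y z m x : X} (h : dX y z < ENNReal.ofReal r)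
    (hm : IsMid m y z) (hx : dX y x < ENNReal.ofReal r) :
      dr x m ^ 2 ≤ dr x y ^ 2 / 2 + dr x z ^ 2 / 2 - dr y z ^ 2 / 4 := by
  obtain ⟨n, hn, hC⟩ := mid_CN0 hr h
  rw [mid_unique hr h hm hn]
  exact hC x hx

lemma busemann3 {r : ℝ} (hr : LocR X r) {x y z m n : X} (hy : dX x y < ENNReal.ofReal r)
    (hz : dX x z < ENNReal.ofReal r) (hm : IsMid m x y) (hn : IsMid n x z) :
    dX m n ≤ dX y z / 2 := by
  have h1 := mid_CN hr hz hn (hm.1.trans_lt (half_lt hy))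
  have h2 := mid_CN hr hy hm hz
  have h3 := dr_half hy hm.1
  have h0 : ∀ a b : X, 0 ≤ dr a b := fun a b => ENNReal.toReal_nonneg
  rw [dr_comm m x, dr_comm m z] at h1
  rw [dr_comm z x, dr_comm z y] at h2
  have h4 : dr m n ≤ dr y z / 2 := by
    have := h0 x m
    have : dr x m ^ 2 ≤ (dr x y / 2) ^ 2 := pow_le_pow_left₀ (h0 _ _) h3 2
    apply le_of_sq_le_sq _ (by have := h0 y z; linarith)
    nlinarith
  have t1 : dX m n ≠ ⊤ := by
    have : dX m n ≤ dX m x + dX x n := dX_triangle _ _ _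
    rw [dX_comm m x] at this
    exact (this.trans_lt (ENNReal.add_lt_top.2 ⟨(hm.1.trans_lt (half_lt hy)).trans ENNReal.ofReal_lt_top,
      (hn.1.trans_lt (half_lt hz)).trans ENNReal.ofReal_lt_top⟩)).ne
  have t2 : dX y z ≠ ⊤ := by
    have : dX y z ≤ dX y x + dX x z := dX_triangle _ _ _
    rw [dX_comm y x] at this
    exact (this.trans_lt (ENNReal.add_lt_top.2 ⟨hy.trans ENNReal.ofReal_lt_top,
      hz.trans ENNReal.ofReal_lt_top⟩)).ne
  rw [← ENNReal.toReal_le_toReal t1 (ENNReal.div_ne_top t2 two_ne_zero), ENNReal.toReal_div]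
  exact h4

lemma busemann {r : ℝ} (hr : LocR X r) {x y x' y' m m' : X} (h : dX x y < ENNReal.ofReal r)
    (h' : dX x' y' < ENNReal.ofReal r) (hd : dX x y' < ENNReal.ofReal r)
    (hm : IsMid m x y) (hm' : IsMid m' x' y') : dX m m' ≤ (dX x x' + dX y y') / 2 := by
  obtain ⟨n, hn⟩ := mid_exists hr hd
  have h1 := busemann3 hr h hd hm hn
  have h2 := busemann3 hr (by rwa [dX_comm]) (by rwa [dX_comm]) hn.symm hm'.symm
  calc dX m m' ≤ dX m n + dX n m' := dX_triangle _ _ _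
    _ ≤ dX y y' / 2 + dX x x' / 2 := add_le_add h1 h2
    _ = _ := by rw [add_comm, ENNReal.add_div]

open Classical in
def mid (x y : X) : X := if h : ∃ m, IsMid m x y then h.choose else x

lemma mid_spec {r : ℝ} (hr : LocR X r) {y z : X} (h : dX y z < ENNReal.ofReal r) :
    IsMid (mid y z) y z := by
  have := mid_exists hr h
  unfold mid
  rw [dif_pos this]
  exact this.choose_spec


end

section
variable {X : Set E2}

lemma evar_continuous {f : unitInterval → E2} (hf : Continuous f)
    (hb : BoundedVariationOn f Set.univ) :
    Continuous (variationOnFromTo f Set.univ 0) := by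
  rw [continuous_iff_continuousAt]
  intro x
  have hl := hb.tendsto_eVariationOn_Icc_zero_left (x := x) hf.continuousWithinAt
  have hr := hb.tendsto_eVariationOn_Icc_zero_right x hf.continuousWithinAt
  rw [nhdsWithin_univ] at hl hr
  have hl' := (ENNReal.tendsto_toReal ENNReal.zero_ne_top).comp hl
  have hr' := (ENNReal.tendsto_toReal ENNReal.zero_ne_top).comp hr
  have hs := hl'.add hr'
  simp only [ENNReal.toReal_zero, add_zero, Function.comp_def] at hs
  rw [ContinuousAt, tendsto_iff_dist_tendsto_zero]
  refine squeeze_zero (fun _ => dist_nonneg) (fun t => ?_) hs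
  rw [Real.dist_eq, variationOnFromTo.sub_right hb.locallyBoundedVariationOn
    (Set.mem_univ _) (Set.mem_univ _) (Set.mem_univ _)]
  rcases le_total x t with h | h
  · rw [variationOnFromTo.eq_of_le _ _ h, abs_of_nonneg ENNReal.toReal_nonneg]
    exact le_add_of_nonneg_left ENNReal.toReal_nonneg
  · rw [variationOnFromTo.eq_of_ge _ _ h, abs_neg, abs_of_nonneg ENNReal.toReal_nonneg]
    exact le_add_of_nonneg_right ENNReal.toReal_nonneg

lemma lip_reparam {x y : X} (q : Path x y) (hq : cost q ≠ ⊤) :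
    ∃ q' : Path x y, q.Homotopic q' ∧
      ∀ s t : unitInterval, dist (q' s : E2) (q' t) ≤ (cost q).toReal * |(s : ℝ) - t| := by
  set f : unitInterval → E2 := fun t => (q t : E2) with hf
  have hfc : Continuous f := by fun_prop
  have hb : BoundedVariationOn f Set.univ := hq
  set V := variationOnFromTo f Set.univ 0 with hV
  have hVc : Continuous V := evar_continuous hfc hb
  set ℓ := (cost q).toReal with hℓ
  have hd : ∀ s t, dist (f s) (f t) ≤ |V s - V t| := by
    have : ∀ s t, s ≤ t → dist (f s) (f t) ≤ |V s - V t| := by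
      intro s t h
      rw [hV, variationOnFromTo.sub_right hb.locallyBoundedVariationOn
        (Set.mem_univ _) (Set.mem_univ _) (Set.mem_univ _), variationOnFromTo.eq_of_ge _ _ h, abs_neg,
        abs_of_nonneg ENNReal.toReal_nonneg, dist_edist]
      refine ENNReal.toReal_mono (ne_top_of_le_ne_top hb (eVariationOn.mono _ Set.inter_subset_left)) ?_
      exact eVariationOn.edist_le _ ⟨Set.mem_univ _, le_rfl, h⟩ ⟨Set.mem_univ _, h, le_rfl⟩
    intro s t
    rcases le_total s t with h | h
    · exact this s t h
    · rw [dist_comm, abs_sub_comm]; exact this t s h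
  have V0 : V 0 = 0 := variationOnFromTo.self _ _ _
  have V1 : V 1 = ℓ := by
    rw [hV, variationOnFromTo.eq_of_le _ _ zero_le_one]
    have : (Set.univ ∩ Set.Icc (0 : unitInterval) 1) = Set.univ := by
      ext t; simp [unitInterval.le_one']
    rw [this]; rfl
  have Vnn : ∀ t, 0 ≤ V t := fun t => variationOnFromTo.nonneg_of_le _ _ unitInterval.nonneg'
  have Vle : ∀ t, V t ≤ ℓ := fun t =>
    (le_abs_self _).trans (variationOnFromTo.abs_le_eVariationOn hb)
  have hℓ0 : 0 ≤ ℓ := ENNReal.toReal_nonneg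
  rcases hℓ0.eq_or_lt with h0 | h0
  · refine ⟨q, Path.Homotopic.refl q, fun s t => ?_⟩
    have := hd s t
    have e1 : V s = 0 := le_antisymm (by rw [h0]; exact Vle s) (Vnn s)
    have e2 : V t = 0 := le_antisymm (by rw [h0]; exact Vle t) (Vnn t)
    rw [e1, e2] at this
    simpa [← h0] using this
  have hT : ∀ u : unitInterval, ∃ t, V t = ℓ * u := by
    intro u
    have := intermediate_value_univ 0 1 hVc
    rw [V0, V1] at this
    exact this ⟨mul_nonneg hℓ0 u.2.1, mul_le_of_le_one_right hℓ0 u.2.2⟩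
  choose T hT using hT
  have hlip : ∀ s t : unitInterval, dist (q (T s) : E2) (q (T t)) ≤ ℓ * |(s : ℝ) - t| := by
    intro s t
    refine (hd _ _).trans ?_
    rw [hT, hT, ← mul_sub, abs_mul, abs_of_nonneg hℓ0]
  have heq : ∀ s t, V s = V t → q s = q t := by
    intro s t h
    have := hd s t
    rw [h, sub_self, abs_zero] at this
    exact Subtype.ext (dist_le_zero.1 this)
  let q' : Path x y :=
    { toFun := fun t => q (T t)
      continuous_toFun := by
        refine LipschitzWith.continuous (K := Real.toNNReal ℓ) (LipschitzWith.of_dist_le_mul ?_)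
        intro s t
        rw [Real.coe_toNNReal _ hℓ0]
        exact hlip s t
      source' := by
        rw [heq (T 0) 0 (by rw [hT, V0]; simp)]; simp
      target' := by
        rw [heq (T 1) 1 (by rw [hT, V1]; simp)]; simp }
  refine ⟨q', ?_, hlip⟩
  let φ : unitInterval → unitInterval := fun t => ⟨V t / ℓ, div_nonneg (Vnn t) hℓ0,
    div_le_one_of_le₀ (Vle t) hℓ0⟩
  have hφ : Continuous φ := by
    refine Continuous.subtype_mk (hVc.div_const ℓ) _
  have φ0 : φ 0 = 0 := Subtype.ext (by simp [φ, V0])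
  have φ1 : φ 1 = 1 := Subtype.ext (by simp [φ, V1, h0.ne'])
  have e : q = q'.reparam φ hφ φ0 φ1 := by
    ext t
    show (q t : E2) _ = (q (T (φ t)) : E2) _
    rw [heq (T (φ t)) t (by rw [hT]; simp only [φ]; field_simp)]
  have hh : q'.Homotopic (q'.reparam φ hφ φ0 φ1) := ⟨Path.Homotopy.reparam q' φ hφ φ0 φ1⟩
  rw [← e] at hh
  exact hh.symm

lemma cost_congr {x y x' y' : X} (σ : Path x y) (τ : Path x' y') (h : ∀ t, σ t = τ t) :
    cost σ = cost τ := by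
  unfold cost
  apply eVariationOn.congr
  intro t _
  simp [h]

lemma cost_le_lip {x y : X} {L : ℝ} (hL : 0 ≤ L) (q : Path x y)
    (h : ∀ s t : unitInterval, dist (q s : E2) (q t) ≤ L * |(s : ℝ) - t|) :
    cost q ≤ ENNReal.ofReal L := by
  have := evar_le_of_lip (f := fun t => (q t : E2)) hL
    (s := Set.univ) (a := 0) (b := 1) (fun t _ => ⟨t.2.1, t.2.2⟩) zero_le_one h
  unfold cost
  simpa using this

lemma cost_subpath_lip {x y : X} {L : ℝ} (hL : 0 ≤ L) (q : Path x y)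
    (h : ∀ s t : unitInterval, dist (q s : E2) (q t) ≤ L * |(s : ℝ) - t|)
    (a b : unitInterval) :
    cost (subpath q a b) ≤ ENNReal.ofReal (L * |(b : ℝ) - a|) := by
  apply cost_le_lip (by positivity)
  intro s t
  refine (h _ _).trans (le_of_eq ?_)
  rw [mul_assoc, ← abs_mul]
  congr 1
  rw [show (b - a : ℝ) * (s - t) = (1 - s) * a + s * b - ((1 - t) * a + t * b) by ring]


end

section

section PE
variable {Y : Type*} [TopologicalSpace Y]

/-- homotopy of paths up to propositional equality of endpoints -/
def PEq {x y x' y' : Y} (σ : Path x y) (τ : Path x' y') : Prop :=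
  ∃ (hx : x = x') (hy : y = y'), σ.Homotopic (τ.cast hx hy)

lemma PEq.of_hom {x y : Y} {σ τ : Path x y} (h : σ.Homotopic τ) : PEq σ τ := ⟨rfl, rfl, h⟩

lemma PEq.hom {x y : Y} {σ τ : Path x y} (h : PEq σ τ) : σ.Homotopic τ := by
  obtain ⟨_, _, h⟩ := h; exact h

lemma PEq.rfl' {x y : Y} (σ : Path x y) : PEq σ σ := ⟨rfl, rfl, Path.Homotopic.refl _⟩

lemma PEq.symm {x y x' y' : Y} {σ : Path x y} {τ : Path x' y'} (h : PEq σ τ) : PEq τ σ := by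
  obtain ⟨rfl, rfl, h⟩ := h; exact ⟨rfl, rfl, h.symm⟩

lemma PEq.trans {x y x' y' x'' y'' : Y} {σ : Path x y} {τ : Path x' y'} {υ : Path x'' y''}
    (h : PEq σ τ) (h' : PEq τ υ) : PEq σ υ := by
  obtain ⟨rfl, rfl, h⟩ := h; obtain ⟨rfl, rfl, h'⟩ := h'; exact ⟨rfl, rfl, h.trans h'⟩

lemma PEq.of_fun {x y x' y' : Y} {σ : Path x y} {τ : Path x' y'} (h : ∀ t, σ t = τ t) :
    PEq σ τ := by
  have hx : x = x' := by have := h 0; simpa using this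
  have hy : y = y' := by have := h 1; simpa using this
  subst hx; subst hy
  have : σ = τ := by ext t; exact h t
  rw [this]; exact PEq.rfl' _

lemma PEq.cast_left {x y x' y' : Y} (σ : Path x y) (hx : x' = x) (hy : y' = y) :
    PEq (σ.cast hx hy) σ := PEq.of_fun (fun _ => rfl)

lemma PEq.comp {x y z x' y' z' : Y} {σ : Path x y} {τ : Path y z} {σ' : Path x' y'}
    {τ' : Path y' z'} (h : PEq σ σ') (h' : PEq τ τ') : PEq (σ.trans τ) (σ'.trans τ') := by
  obtain ⟨rfl, rfl, h⟩ := h; obtain ⟨_, rfl, h'⟩ := h'; exact ⟨rfl, rfl, h.hcomp h'⟩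

lemma PEq.comp_symm {x y x' y' : Y} {σ : Path x y} {σ' : Path x' y'}
    (h : PEq σ σ') : PEq σ.symm σ'.symm := by
  obtain ⟨rfl, rfl, h⟩ := h; exact ⟨rfl, rfl, h.symm₂⟩

lemma PEq.refl_trans {x y z : Y} (σ : Path x y) (τ : Path z z) (h : PEq τ (Path.refl x))
    (e : z = x) : PEq (τ.trans (σ.cast e rfl)) σ := by
  subst e
  exact (PEq.comp h (PEq.rfl' _)).trans (PEq.of_hom (Path.Homotopic.refl_trans σ))

lemma chain_congr {x y : ℕ → Y} {α : ∀ i, Path (x i) (x (i + 1))} {β : ∀ i, Path (y i) (y (i + 1))}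
    (n : ℕ) (h0 : x 0 = y 0) (h : ∀ i < n, PEq (α i) (β i)) : PEq (chain x α n) (chain y β n) := by
  induction n with
  | zero => exact PEq.of_fun (fun t => by simpa [chain] using h0)
  | succ n ih => exact PEq.comp (ih fun i hi => h i (by omega)) (h n (by omega))

lemma chain_refl (x : Y) (n : ℕ) :
    PEq (chain (fun _ => x) (fun _ => Path.refl x) n) (Path.refl x) := by
  induction n with
  | zero => exact PEq.rfl' _
  | succ n ih => exact (PEq.comp ih (PEq.rfl' _)).trans (PEq.of_hom (Path.Homotopic.refl_trans _))

lemma subpath_trans {a b : Y} (σ : Path a b) (r s t : unitInterval) :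
    PEq ((subpath σ r s).trans (subpath σ s t)) (subpath σ r t) := by
  have e : ∀ r s, subpath σ r s = σ.subpath r s := by
    intro r s; ext u
    show σ _ = σ _
    congr 1
  rw [e, e, e]
  exact PEq.of_hom ⟨Path.Homotopy.subpathTransSubpath σ r s t⟩

lemma subpath_self {a b : Y} (σ : Path a b) (s : unitInterval) :
    PEq (subpath σ s s) (Path.refl (σ s)) := by
  refine PEq.of_fun fun t => ?_
  show σ _ = σ s
  congr 1; apply Subtype.ext; show (1 - (t : ℝ)) * s + t * s = s; ring

lemma subpath_full {a b : Y} (σ : Path a b) : PEq (subpath σ 0 1) σ := by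
  refine PEq.of_fun fun t => ?_
  show σ _ = σ t
  congr 1; apply Subtype.ext; simp

lemma chain_subpath {a b : Y} (σ : Path a b) (s : ℕ → unitInterval) (n : ℕ) :
    PEq (chain (fun j => σ (s j)) (fun j => subpath σ (s j) (s (j + 1))) n)
      (subpath σ (s 0) (s n)) := by
  induction n with
  | zero => exact (subpath_self σ _).symm
  | succ n ih => exact (PEq.comp ih (PEq.rfl' _)).trans (subpath_trans σ _ _ _)

lemma subpath0_peq {a b : Y} (σ : Path a b) (t : unitInterval) :
    PEq (subpath0 σ t) (subpath σ 0 t) := PEq.cast_left _ _ _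

open Path.Homotopic in
lemma trans_assoc' {x y z w : Y} (p : Path x y) (q : Path y z) (r : Path z w) :
    PEq ((p.trans q).trans r) (p.trans (q.trans r)) :=
  PEq.of_hom (Path.Homotopic.trans_assoc p q r)

/-- ladder -/
lemma ladder {a b : ℕ → Y} (α : ∀ i, Path (a i) (a (i + 1))) (β : ∀ i, Path (b i) (b (i + 1)))
    (e : ∀ i, Path (a i) (b i)) (n : ℕ)
    (h : ∀ i < n, ((α i).trans (e (i + 1))).Homotopic ((e i).trans (β i))) :
    PEq ((chain a α n).trans (e n)) ((e 0).trans (chain b β n)) := by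
  induction n with
  | zero =>
    exact (PEq.of_hom (Path.Homotopic.refl_trans (e 0))).trans
      (PEq.of_hom (Path.Homotopic.trans_refl (e 0))).symm
  | succ n ih =>
    have ih := ih fun i hi => h i (by omega)
    have h1 := trans_assoc' (chain a α n) (α n) (e (n + 1))
    have h2 := PEq.comp (PEq.rfl' (chain a α n)) (PEq.of_hom (h n (by omega)))
    have h3 := trans_assoc' (chain a α n) (e n) (β n)
    have h4 := PEq.comp ih (PEq.rfl' (β n))
    have h5 := trans_assoc' (e 0) (chain b β n) (β n)
    exact h1.trans (h2.trans (h3.symm.trans (h4.trans h5)))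

lemma grid_ladder {h : ℕ → ℕ → Y} (α : ∀ k j, Path (h k j) (h k (j + 1)))
    (e : ∀ k j, Path (h k j) (h (k + 1) j)) (J : ℕ) (k : ℕ)
    (sq : ∀ i < k, ∀ j < J, ((α i j).trans (e i (j + 1))).Homotopic ((e i j).trans (α (i + 1) j))) :
    PEq ((chain (h 0) (α 0) J).trans (chain (fun i => h i J) (fun i => e i J) k))
      ((chain (fun i => h i 0) (fun i => e i 0) k).trans (chain (h k) (α k) J)) := by
  induction k with
  | zero =>
    exact (PEq.of_hom (Path.Homotopic.trans_refl _)).trans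
      (PEq.of_hom (Path.Homotopic.refl_trans _)).symm
  | succ k ih =>
    have ih := ih fun i hi => sq i (by omega)
    have h1 := ladder (α k) (α (k + 1)) (fun j => e k j) J (sq k (by omega))
    have a1 := (trans_assoc' (chain (h 0) (α 0) J) (chain (fun i => h i J) (fun i => e i J) k)
      (e k J)).symm
    have a2 := PEq.comp ih (PEq.rfl' (e k J))
    have a3 := trans_assoc' (chain (fun i => h i 0) (fun i => e i 0) k) (chain (h k) (α k) J) (e k J)
    have a4 := PEq.comp (PEq.rfl' (chain (fun i => h i 0) (fun i => e i 0) k)) h1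
    have a5 := (trans_assoc' (chain (fun i => h i 0) (fun i => e i 0) k) (e k 0)
      (chain (h (k + 1)) (α (k + 1)) J)).symm
    exact a1.trans (a2.trans (a3.trans (a4.trans a5)))

end PE

variable {X : Set E2}

lemma mCost_le_of_peq {x y x' y' : X} {σ : Path x y} {τ : Path x' y'} (h : PEq σ τ) :
    mCost σ ≤ cost τ := by
  obtain ⟨rfl, rfl, h⟩ := h
  exact iInf_le_of_le ⟨τ, h⟩ le_rfl

lemma mCost_congr {x y x' y' : X} {σ : Path x y} {τ : Path x' y'} (h : PEq σ τ) :
    mCost σ = mCost τ := by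
  apply le_antisymm
  · apply le_iInf; rintro ⟨υ, hυ⟩; exact mCost_le_of_peq (h.trans (PEq.of_hom hυ))
  · apply le_iInf; rintro ⟨υ, hυ⟩; exact mCost_le_of_peq (h.symm.trans (PEq.of_hom hυ))

lemma mCost_trans_le {x y z : X} (σ : Path x y) (τ : Path y z) :
    mCost (σ.trans τ) ≤ mCost σ + cost τ := by
  unfold mCost
  rw [ENNReal.iInf_add]
  apply le_iInf; rintro ⟨υ, hυ⟩
  show _ ≤ cost υ + _
  rw [← cost_trans]
  exact mCost_le_of_peq (PEq.of_hom (hυ.hcomp (Path.Homotopic.refl _)))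

lemma cost_chain (x : ℕ → X) (α : ∀ i, Path (x i) (x (i + 1))) (n : ℕ) :
    cost (chain x α n) = ∑ i ∈ Finset.range n, cost (α i) := by
  induction n with
  | zero =>
    simp only [Finset.range_zero, Finset.sum_empty]
    unfold cost
    rw [eVariationOn.constant_on]
    rintro _ ⟨_, _, rfl⟩ _ ⟨_, _, rfl⟩
    simp [chain]
  | succ n ih => rw [chain, cost_trans, ih, Finset.sum_range_succ]

/-- sampled lengths are bounded by the cost -/
lemma cost_subpath {x y : X} (σ : Path x y) {a b : unitInterval} (hab : a ≤ b) :
    cost (subpath σ a b) ≤ eVariationOn (fun t => (σ t : E2)) (Set.Icc a b) := by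
  refine eVariationOn.comp_le_of_monotoneOn (fun t => (σ t : E2))
    (fun s : unitInterval => (⟨(1 - s.1) * a.1 + s.1 * b.1, subIcc_mem s a b⟩ : unitInterval))
    ?_ ?_
  · intro s _ t _ hst
    have h1 : (s : ℝ) ≤ t := hst
    have h2 : (a : ℝ) ≤ b := hab
    show (1 - s.1) * a.1 + s.1 * b.1 ≤ (1 - t.1) * a.1 + t.1 * b.1
    nlinarith
  · intro s _
    have h2 : (a : ℝ) ≤ b := hab
    have h3 := s.2.1
    have h4 := s.2.2
    constructor
    · show a.1 ≤ (1 - s.1) * a.1 + s.1 * b.1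
      nlinarith
    · show (1 - s.1) * a.1 + s.1 * b.1 ≤ b.1
      nlinarith

lemma sum_dX_le {x y : X} (σ : Path x y) {s : ℕ → unitInterval} (hs : Monotone s) (n : ℕ) :
    ∑ j ∈ Finset.range n, dX (σ (s j)) (σ (s (j + 1))) ≤ cost σ := by
  calc _ ≤ ∑ j ∈ Finset.range n, eVariationOn (fun t => (σ t : E2)) (Set.Icc (s j) (s (j + 1))) :=
        Finset.sum_le_sum fun j _ => (dX_le_cost _).trans (cost_subpath σ (hs (Nat.le_succ j)))
    _ = eVariationOn (fun t => (σ t : E2)) (Set.Icc (s 0) (s n)) :=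
        eVariationOn.sum' _ hs
    _ ≤ cost σ := eVariationOn.mono _ (Set.subset_univ _)


end

section
variable {X : Set E2}

def pt (n k : ℕ) : unitInterval := Set.projIcc 0 1 zero_le_one ((k : ℝ) / n)

lemma pt_zero (n : ℕ) : pt n 0 = 0 := by
  unfold pt; simp

lemma pt_of_le {n k : ℕ} (hn : 0 < n) (h : k ≤ n) : ((pt n k : unitInterval) : ℝ) = k / n := by
  unfold pt
  rw [Set.projIcc_of_mem]
  have : (0 : ℝ) < n := by exact_mod_cast hn
  exact ⟨by positivity, by rw [div_le_one this]; exact_mod_cast h⟩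

lemma pt_ge {n k : ℕ} (hn : 0 < n) (h : n ≤ k) : pt n k = 1 := by
  unfold pt
  have : (0 : ℝ) < n := by exact_mod_cast hn
  exact Set.projIcc_of_right_le _ (by rw [one_le_div this]; exact_mod_cast h)

lemma pt_mono (n : ℕ) : Monotone (pt n) := by
  intro a b h
  apply Set.monotone_projIcc
  gcongr

lemma pt_dist (n k : ℕ) : dist (pt n k) (pt n (k + 1)) ≤ 1 / n := by
  have := (LipschitzWith.projIcc (a := (0 : ℝ)) (b := 1) zero_le_one).dist_le_mul
    ((k : ℝ) / n) (((k + 1 : ℕ) : ℝ) / n)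
  refine this.trans (le_of_eq ?_)
  rw [NNReal.coe_one, one_mul, Real.dist_eq]
  rw [← sub_div, abs_div, Nat.abs_cast]
  push_cast
  congr 1
  rw [abs_sub_comm]; simp

lemma relax_conv {n : ℕ} (L : ℕ → ℕ → ℝ) {M B : ℝ} (hM : 0 ≤ M) (hB0 : 0 ≤ B)
    (hB : ∀ k, L 0 k ≤ B) (h0 : ∀ m, L m 0 ≤ M) (hn : ∀ m, L m n ≤ M)
    (hstep : ∀ m k, 0 < k → k < n → L (m + 1) k ≤ (L m (k - 1) + L m (k + 1)) / 2)
    {ε : ℝ} (hε : 0 < ε) : ∃ m, ∀ k ≤ n, L m k ≤ M + ε := by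
  rcases Nat.eq_zero_or_pos n with rfl | hnp
  · exact ⟨0, fun k hk => by rw [Nat.le_zero.1 hk]; linarith [h0 0]⟩
  have hnr : (1 : ℝ) ≤ n := by exact_mod_cast hnp
  set ρ : ℝ := 1 - 1 / (n : ℝ) ^ 2 with hρ
  have hn2 : (1 : ℝ) ≤ (n : ℝ) ^ 2 := one_le_pow₀ hnr
  have hi : 1 / (n : ℝ) ^ 2 ≤ 1 := by rw [div_le_one (by linarith)]; exact hn2
  have hρ0 : 0 ≤ ρ := by linarith
  have hρ1 : ρ < 1 := by
    have : 0 < 1 / (n : ℝ) ^ 2 := by positivity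
    linarith
  have key : ∀ m, ∀ k ≤ n, L m k ≤ M + B * ρ ^ m * (k * (n - k)) := by
    intro m
    induction m with
    | zero =>
      intro k hk
      rcases Nat.eq_zero_or_pos k with rfl | hk0
      · simpa using h0 0
      rcases hk.eq_or_lt with rfl | hk1
      · simpa using hn 0
      have a1 : (1 : ℝ) ≤ k := by exact_mod_cast hk0
      have a2 : (k : ℝ) + 1 ≤ n := by exact_mod_cast hk1
      have a3 : (1 : ℝ) ≤ k * (n - k) := by nlinarith
      have := hB k
      rw [pow_zero, mul_one]
      nlinarith
    | succ m ih =>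
      intro k hk
      rcases Nat.eq_zero_or_pos k with rfl | hk0
      · simpa using h0 (m + 1)
      rcases hk.eq_or_lt with rfl | hk1
      · simpa using hn (m + 1)
      refine (hstep m k hk0 hk1).trans ?_
      have i1 := ih (k - 1) (by omega)
      have i2 := ih (k + 1) (by omega)
      rw [Nat.cast_sub hk0] at i1
      push_cast at i1 i2
      have c0 : 0 ≤ B * ρ ^ m := by positivity
      have a1 : (1 : ℝ) ≤ k := by exact_mod_cast hk0
      have a2 : (k : ℝ) + 1 ≤ n := by exact_mod_cast hk1
      have w : (k : ℝ) * (n - k) - 1 ≤ ρ * (k * (n - k)) := by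
        have : (k : ℝ) * (n - k) ≤ (n : ℝ) ^ 2 := by nlinarith
        have : 1 / (n : ℝ) ^ 2 * (k * (n - k)) ≤ 1 := by
          rw [one_div, inv_mul_le_iff₀ (by linarith)]; linarith
        rw [hρ]; linarith
      have := mul_le_mul_of_nonneg_left w c0
      rw [pow_succ]
      nlinarith
  have ht : Filter.Tendsto (fun m => B * (n : ℝ) ^ 2 * ρ ^ m) Filter.atTop (nhds (B * (n : ℝ) ^ 2 * 0)) :=
    (tendsto_pow_atTop_nhds_zero_of_lt_one hρ0 hρ1).const_mul _
  rw [mul_zero] at ht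
  obtain ⟨m, hm⟩ := (ht.eventually (gt_mem_nhds hε)).exists
  refine ⟨m, fun k hk => (key m k hk).trans ?_⟩
  have c0 : 0 ≤ B * ρ ^ m := by positivity
  have a2 : (k : ℝ) ≤ n := by exact_mod_cast hk
  have a1 : (0 : ℝ) ≤ k := by positivity
  have : (k : ℝ) * (n - k) ≤ (n : ℝ) ^ 2 := by nlinarith
  have := mul_le_mul_of_nonneg_left this c0
  linarith

/-- one relaxation step -/
def relax (n : ℕ) (h : ℕ → ℕ → X) : ℕ → ℕ → X := fun k j =>
  if 0 < k ∧ k < n then mid (h (k - 1) j) (h (k + 1) j) else h k j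

def CloseGrid (η : ENNReal) (h : ℕ → ℕ → X) : Prop :=
  (∀ k j, dX (h k j) (h (k + 1) j) ≤ η) ∧ (∀ k j, dX (h k j) (h k (j + 1)) ≤ η)

lemma relax_in {n : ℕ} (h : ℕ → ℕ → X) {k : ℕ} (j : ℕ) (hk : 0 < k) (hk' : k < n) :
    relax n h k j = mid (h (k - 1) j) (h (k + 1) j) := if_pos ⟨hk, hk'⟩

lemma relax_out {n : ℕ} (h : ℕ → ℕ → X) {k : ℕ} (j : ℕ) (hk : ¬ (0 < k ∧ k < n)) :
    relax n h k j = h k j := if_neg hk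

lemma close2 {η : ENNReal} {h : ℕ → ℕ → X} (hc : CloseGrid η h) {k : ℕ} (hk : 0 < k) (j : ℕ) :
    dX (h (k - 1) j) (h (k + 1) j) ≤ 2 * η := by
  refine (dX_triangle _ (h k j) _).trans ?_
  rw [two_mul]
  have := hc.1 (k - 1) j
  rw [Nat.sub_add_cancel hk] at this
  exact add_le_add this (hc.1 k j)

lemma relax_mid {r : ℝ} (hr : LocR X r) {η : ENNReal} (hη : 3 * η < ENNReal.ofReal r) {n : ℕ}
    {h : ℕ → ℕ → X} (hc : CloseGrid η h) {k : ℕ} (j : ℕ) (hk : 0 < k) (hk' : k < n) :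
    IsMid (relax n h k j) (h (k - 1) j) (h (k + 1) j) := by
  rw [relax_in h j hk hk']
  refine mid_spec hr ((close2 hc hk j).trans_lt (lt_of_le_of_lt ?_ hη))
  gcongr; norm_num

lemma relax_row {r : ℝ} (hr : LocR X r) {η : ENNReal} (hη : 3 * η < ENNReal.ofReal r) {n : ℕ}
    {h : ℕ → ℕ → X} (hc : CloseGrid η h) {k : ℕ} (j : ℕ) (hk : 0 < k) (hk' : k < n) :
    dX (relax n h k j) (relax n h k (j + 1)) ≤
      (dX (h (k - 1) j) (h (k - 1) (j + 1)) + dX (h (k + 1) j) (h (k + 1) (j + 1))) / 2 := by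
  have h23 : 2 * η < ENNReal.ofReal r := lt_of_le_of_lt (by gcongr; norm_num) hη
  refine busemann hr ((close2 hc hk j).trans_lt h23) ((close2 hc hk (j + 1)).trans_lt h23) ?_
    (relax_mid hr hη hc j hk hk') (relax_mid hr hη hc (j + 1) hk hk')
  refine lt_of_le_of_lt ?_ hη
  refine (dX_triangle _ (h (k + 1) j) _).trans ?_
  rw [show (3 : ENNReal) * η = 2 * η + η by ring]
  exact add_le_add (close2 hc hk j) (hc.2 _ _)

lemma avg_le {a b η : ENNReal} (ha : a ≤ η) (hb : b ≤ η) : (a + b) / 2 ≤ η := by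
  rw [ENNReal.div_le_iff_le_mul (by simp) (by simp), mul_two]
  exact add_le_add ha hb

lemma half_le' {a η : ENNReal} (ha : a ≤ 2 * η) : a / 2 ≤ η := by
  rw [ENNReal.div_le_iff_le_mul (by simp) (by simp), mul_comm]
  exact ha

lemma relax_close {r : ℝ} (hr : LocR X r) {η : ENNReal} (hη : 3 * η < ENNReal.ofReal r) {n : ℕ}
    {h : ℕ → ℕ → X} (hc : CloseGrid η h) : CloseGrid η (relax n h) := by
  constructor
  · intro k j
    by_cases h1 : 0 < k ∧ k < n
    · have m1 := relax_mid hr hη hc j h1.1 h1.2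
      by_cases h2 : 0 < k + 1 ∧ k + 1 < n
      · have m2 := relax_mid hr hη hc j h2.1 h2.2
        have h23 : 2 * η < ENNReal.ofReal r := lt_of_le_of_lt (by gcongr; norm_num) hη
        refine (busemann hr ((close2 hc h1.1 j).trans_lt h23) ((close2 hc h2.1 j).trans_lt h23) ?_
          m1 m2).trans (avg_le ?_ ?_)
        · refine lt_of_le_of_lt ?_ hη
          refine (dX_triangle _ (h (k + 1) j) _).trans ?_
          rw [show (3 : ENNReal) * η = 2 * η + η by ring]
          exact add_le_add (close2 hc h1.1 j) (hc.1 _ _)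
        · have := hc.1 (k - 1) j
          rwa [Nat.sub_add_cancel h1.1] at this
        · exact hc.1 _ _
      · rw [relax_out h j h2]
        exact m1.2.trans (half_le' (close2 hc h1.1 j))
    · rw [relax_out h j h1]
      by_cases h2 : 0 < k + 1 ∧ k + 1 < n
      · have m2 := relax_mid hr hη hc j h2.1 h2.2
        exact m2.1.trans (half_le' (close2 hc h2.1 j))
      · rw [relax_out h j h2]; exact hc.1 k j
  · intro k j
    by_cases h1 : 0 < k ∧ k < n
    · exact (relax_row hr hη hc j h1.1 h1.2).trans (avg_le (hc.2 _ _) (hc.2 _ _))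
    · rw [relax_out h j h1, relax_out h _ h1]; exact hc.2 k j

lemma relax_col {r : ℝ} (hr : LocR X r) {η : ENNReal} (hη : 3 * η < ENNReal.ofReal r) {n : ℕ}
    {h : ℕ → ℕ → X} (hc : CloseGrid η h) (j : ℕ)
    (hm : ∀ k, 0 < k → k < n → IsMid (h k j) (h (k - 1) j) (h (k + 1) j)) (k : ℕ) :
    relax n h k j = h k j := by
  by_cases h1 : 0 < k ∧ k < n
  · refine mid_unique hr ?_ (relax_mid hr hη hc j h1.1 h1.2) (hm k h1.1 h1.2)
    exact (close2 hc h1.1 j).trans_lt (lt_of_le_of_lt (by gcongr; norm_num) hη)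
  · exact relax_out h j h1

/-- full relaxation -/
lemma relax_exists {r : ℝ} (hr : LocR X r) {η : ENNReal} (hη : 3 * η < ENNReal.ofReal r) {n J : ℕ}
    {h : ℕ → ℕ → X} (hc : CloseGrid η h)
    (c0 : ∀ k, 0 < k → k < n → IsMid (h k 0) (h (k - 1) 0) (h (k + 1) 0))
    (cJ : ∀ k, 0 < k → k < n → IsMid (h k J) (h (k - 1) J) (h (k + 1) J))
    {M : ℝ} (hM : 0 ≤ M)
    (r0 : ∑ j ∈ Finset.range J, dX (h 0 j) (h 0 (j + 1)) ≤ ENNReal.ofReal M)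
    (rn : ∑ j ∈ Finset.range J, dX (h n j) (h n (j + 1)) ≤ ENNReal.ofReal M)
    {ε : ℝ} (hε : 0 < ε) :
    ∃ g : ℕ → ℕ → X, CloseGrid η g ∧ (∀ j, g 0 j = h 0 j) ∧ (∀ k, g k 0 = h k 0) ∧
      (∀ k, g k J = h k J) ∧
      ∀ k ≤ n, ∑ j ∈ Finset.range J, dX (g k j) (g k (j + 1)) ≤ ENNReal.ofReal (M + ε) := by
  set g : ℕ → ℕ → ℕ → X := fun m => (relax n)^[m] h with hg
  have gs : ∀ m, g (m + 1) = relax n (g m) := fun m => Function.iterate_succ_apply' _ _ _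
  have inv : ∀ m, CloseGrid η (g m) ∧ (∀ j, g m 0 j = h 0 j) ∧ (∀ j, g m n j = h n j) ∧
      (∀ k, g m k 0 = h k 0) ∧ (∀ k, g m k J = h k J) := by
    intro m
    induction m with
    | zero => exact ⟨hc, fun _ => rfl, fun _ => rfl, fun _ => rfl, fun _ => rfl⟩
    | succ m ih =>
      obtain ⟨i1, i2, i3, i4, i5⟩ := ih
      rw [gs]
      refine ⟨relax_close hr hη i1, fun j => ?_, fun j => ?_, fun k => ?_, fun k => ?_⟩
      · rw [relax_out _ _ (by simp), i2]
      · rw [relax_out _ _ (by simp), i3]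
      · rw [relax_col hr hη i1 0 (fun k h1 h2 => by simp only [i4]; exact c0 k h1 h2), i4]
      · rw [relax_col hr hη i1 J (fun k h1 h2 => by simp only [i5]; exact cJ k h1 h2), i5]
  have ηt : η ≠ ⊤ := by
    rintro rfl
    simp at hη
  set S : ℕ → ℕ → ENNReal := fun m k => ∑ j ∈ Finset.range J, dX (g m k j) (g m k (j + 1)) with hS
  have Sle : ∀ m k, S m k ≤ J * η := by
    intro m k
    refine (Finset.sum_le_card_nsmul _ _ η (fun j _ => (inv m).1.2 k j)).trans ?_
    simp
  have hJ : (J : ENNReal) * η ≠ ⊤ := ENNReal.mul_ne_top (by simp) ηt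
  have St : ∀ m k, S m k ≠ ⊤ := fun m k => ne_top_of_le_ne_top hJ (Sle m k)
  obtain ⟨m, hm⟩ := relax_conv (n := n) (fun m k => (S m k).toReal) hM
    (B := (J * η).toReal) ENNReal.toReal_nonneg
    (fun k => ENNReal.toReal_mono hJ (Sle 0 k))
    (fun m => by
      refine ENNReal.toReal_le_of_le_ofReal hM ?_
      simp only [hS, (inv m).2.1]; exact r0)
    (fun m => by
      refine ENNReal.toReal_le_of_le_ofReal hM ?_
      simp only [hS, (inv m).2.2.1]; exact rn)
    (fun m k h1 h2 => by
      rw [← ENNReal.toReal_add (St _ _) (St _ _)]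
      have : S (m + 1) k ≤ (S m (k - 1) + S m (k + 1)) / 2 := by
        simp only [hS]
        rw [← Finset.sum_add_distrib, div_eq_mul_inv, Finset.sum_mul]
        refine Finset.sum_le_sum fun j _ => ?_
        rw [gs, ← div_eq_mul_inv]
        exact relax_row hr hη (inv m).1 j h1 h2
      have := ENNReal.toReal_mono (ENNReal.div_ne_top (ENNReal.add_ne_top.2 ⟨St _ _, St _ _⟩)
        two_ne_zero) this
      rwa [ENNReal.toReal_div] at this) hε
  refine ⟨g m, (inv m).1, (inv m).2.1, (inv m).2.2.2.1, (inv m).2.2.2.2, fun k hk => ?_⟩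
  show S m k ≤ _
  rw [← ENNReal.ofReal_toReal (St m k)]
  exact ENNReal.ofReal_le_ofReal (hm k hk)


end

section
variable {X : Set E2}

lemma dX_ge {r : ℝ} (hr : LocR X r) {a b : X} (q : Path a b) {ℓ : ℝ} (hℓ : 0 ≤ ℓ)
    (hq : ∀ s t : unitInterval, dist (q s : E2) (q t) ≤ ℓ * |(s : ℝ) - t|)
    (ho : ∀ q' : Path a b, q.Homotopic q' → ENNReal.ofReal ℓ ≤ cost q')
    {s t : unitInterval} (hst : s ≤ t) (hsm : ℓ * ((t : ℝ) - s) < r) :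
    ENNReal.ofReal (ℓ * ((t : ℝ) - s)) ≤ dX (q s) (q t) := by
  have hst' : (s : ℝ) ≤ t := hst
  have hd : dist (q s : E2) (q t) < r := by
    refine (hq s t).trans_lt ?_
    rwa [abs_sub_comm, abs_of_nonneg (by linarith)]
  obtain ⟨⟨σ, hσ⟩, -⟩ := geo_exists hr hd
  have hsub := cost_subpath_lip hℓ q hq s t
  rw [abs_of_nonneg (by linarith)] at hsub
  have hle : dX (q s) (q t) ≤ ENNReal.ofReal (ℓ * ((t : ℝ) - s)) := (dX_le_cost _).trans hsub
  have hlt : ENNReal.ofReal (ℓ * ((t : ℝ) - s)) < ENNReal.ofReal r :=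
    (ENNReal.ofReal_lt_ofReal_iff hr.1).2 hsm
  have hh : σ.Homotopic (subpath q s t) :=
    small_homotopic' hr _ _ (by rw [hσ]; exact hle.trans_lt hlt) (hsub.trans_lt hlt)
  have hp : PEq (((subpath q 0 s).trans σ).trans (subpath q t 1)) q :=
    ((PEq.comp ((PEq.comp (PEq.rfl' _) (PEq.of_hom hh)).trans (subpath_trans q 0 s t))
      (PEq.rfl' _)).trans (subpath_trans q 0 t 1)).trans (subpath_full q)
  have hm := mCost_le_of_peq hp.symm
  have hm2 : ENNReal.ofReal ℓ ≤ mCost q := le_iInf fun q' => ho q'.1 q'.2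
  have h3 := hm2.trans hm
  rw [cost_trans, cost_trans, hσ] at h3
  have c1 := cost_subpath_lip hℓ q hq 0 s
  have c2 := cost_subpath_lip hℓ q hq t 1
  have s0 := s.2.1
  have t1 := t.2.2
  simp only [Set.Icc.coe_zero, Set.Icc.coe_one, sub_zero] at c1 c2
  rw [abs_of_nonneg s0] at c1
  rw [abs_of_nonneg (by linarith)] at c2
  have hfin : dX (q s) (q t) ≠ ⊤ := (hle.trans_lt ENNReal.ofReal_lt_top).ne
  have h4 : ENNReal.ofReal ℓ ≤ ENNReal.ofReal (ℓ * s) + dX (q s) (q t) + ENNReal.ofReal (ℓ * (1 - t)) :=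
    h3.trans (by gcongr)
  rw [← ENNReal.ofReal_toReal hfin] at h4 ⊢
  rw [← ENNReal.ofReal_add (by positivity) (by positivity),
    ← ENNReal.ofReal_add (by positivity) (mul_nonneg hℓ (by linarith)),
    ENNReal.ofReal_le_ofReal_iff (add_nonneg (by positivity) (mul_nonneg hℓ (by linarith)))] at h4
  apply ENNReal.ofReal_le_ofReal
  nlinarith

lemma q_mid {r : ℝ} (hr : LocR X r) {a b : X} (q : Path a b) {ℓ : ℝ} (hℓ : 0 ≤ ℓ)
    (hq : ∀ s t : unitInterval, dist (q s : E2) (q t) ≤ ℓ * |(s : ℝ) - t|)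
    (ho : ∀ q' : Path a b, q.Homotopic q' → ENNReal.ofReal ℓ ≤ cost q')
    {s m t : unitInterval} {d : ℝ} (hd : 0 ≤ d) (h1 : (m : ℝ) - s = d) (h2 : (t : ℝ) - m = d)
    (hsm : ℓ * (2 * d) < r) : IsMid (q m) (q s) (q t) := by
  have e : (t : ℝ) - s = 2 * d := by linarith
  have := dX_ge hr q hℓ hq ho (s := s) (t := t) (show (s : ℝ) ≤ t by linarith) (by rwa [e])
  rw [e] at this
  have h3 : ENNReal.ofReal (ℓ * d) ≤ dX (q s) (q t) / 2 := by
    rw [show ℓ * d = ℓ * (2 * d) / 2 by ring, ← ofReal_half]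
    exact ENNReal.div_le_div_right this 2
  constructor
  · refine (dX_le_cost (subpath q s m)).trans (le_trans ?_ h3)
    have := cost_subpath_lip hℓ q hq s m
    rwa [h1, abs_of_nonneg hd] at this
  · refine (dX_le_cost (subpath q m t)).trans (le_trans ?_ h3)
    have := cost_subpath_lip hℓ q hq m t
    rwa [h2, abs_of_nonneg hd] at this

lemma subpath_small {x y : X} (σ : Path x y) {c ρ : ℝ}
    (h : ∀ s t : unitInterval, dist s t < c → dist (σ s : E2) (σ t) < ρ)
    {a b : unitInterval} (hab : dist a b < c) (t : unitInterval) :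
    dist (subpath σ a b t : E2) (σ a) < ρ := by
  apply h
  refine lt_of_le_of_lt ?_ hab
  rw [Subtype.dist_eq, Subtype.dist_eq, Real.dist_eq, Real.dist_eq]
  show |(1 - (t : ℝ)) * a + t * b - a| ≤ |(a : ℝ) - b|
  have : (1 - (t : ℝ)) * a + t * b - a = t * (b - a) := by ring
  rw [this, abs_mul, abs_sub_comm (b : ℝ), abs_of_nonneg t.2.1]
  exact mul_le_of_le_one_left (abs_nonneg _) t.2.2

def dbl (s : unitInterval) : unitInterval := Set.projIcc 0 1 zero_le_one (2 * (s : ℝ))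

lemma dbl_mono : Monotone dbl := by
  intro a b h
  apply Set.monotone_projIcc
  have : (a : ℝ) ≤ b := h
  linarith

lemma grid_core (hcomp : IsCompact X)
    (hpoly : ∃ (n : ℕ) (P : Fin n → Finset E2), X = ⋃ i, convexHull ℝ (↑(P i) : Set E2))
    {o a b : X} (τa : Path o a) (τb : Path o b) (q : Path a b) {ℓ ζ : ℝ} (hℓ : 0 ≤ ℓ) (hζ : 0 ≤ ζ)
    (hq : ∀ s t : unitInterval, dist (q s : E2) (q t) ≤ ℓ * |(s : ℝ) - t|)
    (ho : ∀ q' : Path a b, q.Homotopic q' → ENNReal.ofReal ℓ ≤ cost q')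
    (ha : cost τa ≤ ENNReal.ofReal ζ) (hb : cost τb ≤ ENNReal.ofReal ζ)
    (G : unitInterval × unitInterval → X) (hG : Continuous G)
    (G0 : ∀ s, G (0, s) = τa s) (G1 : ∀ s, G (1, s) = τb (dbl s))
    (Go : ∀ t, G (t, 0) = o) (Gq : ∀ t, G (t, 1) = q t) {ε : ℝ} (hε : 0 < ε) :
    ∃ c > 0, ∀ n : ℕ, 0 < n → (1 : ℝ) / n < c → ∀ k ≤ n,
      mCost (τa.trans (subpath0 q (pt n k))) ≤ ENNReal.ofReal (ζ + ε) := by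
  obtain ⟨r, hr⟩ := exists_LocR hcomp hpoly
  have hr0 := hr.1
  obtain ⟨δ, hδ, hδX⟩ := dX_uniform hcomp hpoly (η := r / 4) (by linarith)
  obtain ⟨c, hc, hcG⟩ := Metric.uniformContinuous_iff.1
    (CompactSpace.uniformContinuous_of_continuous hG) (min δ r) (lt_min hδ hr0)
  have hc1 : ∀ p p' : unitInterval × unitInterval, dist p p' < c → dist (G p : E2) (G p') < r :=
    fun p p' h => (hcG h).trans_le (min_le_right _ _)
  have hc2 : ∀ p p' : unitInterval × unitInterval, dist p p' < c →
      dX (G p) (G p') ≤ ENNReal.ofReal (r / 4) :=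
    fun p p' h => (hδX _ _ ((hcG h).trans_le (min_le_left _ _))).le
  refine ⟨min c (r / (2 * ℓ + 1)), lt_min hc (by positivity), fun n hn hnc k hk => ?_⟩
  have hn1 : (1 : ℝ) / n < c := hnc.trans_le (min_le_left _ _)
  have hn2 : ℓ * (2 * (1 / n)) < r := by
    have h1 := hnc.trans_le (min_le_right _ _)
    rw [lt_div_iff₀ (by positivity)] at h1
    have : (0 : ℝ) < 1 / n := by positivity
    nlinarith
  have hnR : (0 : ℝ) < n := by exact_mod_cast hn
  have hpd : ∀ k, dist (pt n k) (pt n (k + 1)) < c := fun k => (pt_dist n k).trans_lt hn1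
  set h : ℕ → ℕ → X := fun k j => G (pt n k, pt n j) with hh
  have hclose : CloseGrid (ENNReal.ofReal (r / 4)) h := by
    constructor
    · intro k j
      apply hc2
      rw [Prod.dist_eq]
      simpa [hc] using hpd k
    · intro k j
      apply hc2
      rw [Prod.dist_eq]
      simpa [hc] using hpd j
  have p1 : pt n n = 1 := pt_ge hn le_rfl
  have hcol0 : ∀ k, h k 0 = o := fun k => by simp only [hh, pt_zero, Go]
  have hcolJ : ∀ k, h k n = q (pt n k) := fun k => by simp only [hh, p1, Gq]
  have hrow0 : ∀ j, h 0 j = τa (pt n j) := fun j => by simp only [hh, pt_zero, G0]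
  have hrown : ∀ j, h n j = τb (dbl (pt n j)) := fun j => by simp only [hh, p1, G1]
  have h3 : 3 * ENNReal.ofReal (r / 4) < ENNReal.ofReal r := by
    rw [show (3 : ENNReal) = ENNReal.ofReal 3 by simp, ← ENNReal.ofReal_mul (by norm_num)]
    exact (ENNReal.ofReal_lt_ofReal_iff hr0).2 (by linarith)
  obtain ⟨g, gc, g0, gk0, gkJ, gs⟩ := relax_exists hr h3 hclose (n := n) (J := n)
    (fun k _ _ => by simp only [hcol0]; exact ⟨by simp [dX_self], by simp [dX_self]⟩)
    (fun k hk0 hkn => by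
      simp only [hcolJ]
      apply q_mid hr q hℓ hq ho (d := 1 / n) (by positivity) _ _ hn2
      · rw [pt_of_le hn (by omega), pt_of_le hn (by omega), Nat.cast_sub hk0]
        push_cast; ring
      · rw [pt_of_le hn (by omega), pt_of_le hn (by omega)]
        push_cast; ring) hζ
    (by simp only [hrow0]; exact (sum_dX_le τa (pt_mono n) n).trans ha)
    (by simp only [hrown]; exact (sum_dX_le τb (s := fun j => dbl (pt n j))
          (dbl_mono.comp (pt_mono n)) n).trans hb) hε
  have hq4 : ENNReal.ofReal (r / 4) < ENNReal.ofReal r :=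
    (ENNReal.ofReal_lt_ofReal_iff hr0).2 (by linarith)
  have hq2 : ENNReal.ofReal (r / 4) + ENNReal.ofReal (r / 4) < ENNReal.ofReal r := by
    rw [← ENNReal.ofReal_add (by linarith) (by linarith)]
    exact (ENNReal.ofReal_lt_ofReal_iff hr0).2 (by linarith)
  have hα : ∀ k j, ∃ σ : Path (g k j) (g k (j + 1)), cost σ = dX (g k j) (g k (j + 1)) :=
    fun k j => (geo_exists hr (dist_lt_of_dX ((gc.2 k j).trans_lt hq4))).1
  have he : ∀ k j, ∃ σ : Path (g k j) (g (k + 1) j), cost σ = dX (g k j) (g (k + 1) j) :=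
    fun k j => (geo_exists hr (dist_lt_of_dX ((gc.1 k j).trans_lt hq4))).1
  choose α hα using hα
  choose e he using he
  have hαη : ∀ k j, cost (α k j) ≤ ENNReal.ofReal (r / 4) := fun k j => (hα k j).le.trans (gc.2 k j)
  have heη : ∀ k j, cost (e k j) ≤ ENNReal.ofReal (r / 4) := fun k j => (he k j).le.trans (gc.1 k j)
  have L := grid_ladder α e n k (fun i _ j _ => small_homotopic' hr _ _
    (by rw [cost_trans]; exact (add_le_add (hαη _ _) (heη _ _)).trans_lt hq2)
    (by rw [cost_trans]; exact (add_le_add (heη _ _) (hαη _ _)).trans_lt hq2))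
  -- small paths agree
  have small : ∀ {x y x' y' : X} (σ : Path x y) (τ : Path x' y'), x = x' → y = y' →
      (∀ t, dist (σ t : E2) x < r) → (∀ t, dist (τ t : E2) x' < r) → PEq σ τ := by
    intro x y x' y' σ τ hx hy h1 h2
    subst hx; subst hy
    exact PEq.of_hom (small_homotopic hr σ τ h1 h2)
  have row0 : PEq (chain (g 0) (α 0) n) τa := by
    refine (chain_congr (y := fun j => τa (pt n j))
      (β := fun j => subpath τa (pt n j) (pt n (j + 1))) n (by rw [g0, hrow0]) fun j _ => ?_).trans
      ((chain_subpath τa (pt n) n).trans (by rw [pt_zero, p1]; exact subpath_full τa))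
    apply small _ _ (by rw [g0, hrow0]) (by rw [g0, hrow0])
    · exact dist_lt_of_cost _ ((hαη _ _).trans_lt hq4)
    · refine subpath_small τa (c := c) (fun s t hst => ?_) (hpd j)
      rw [← G0, ← G0]
      apply hc1
      rw [Prod.dist_eq]
      simpa [hc] using hst
  have colJ : PEq (chain (fun i => g i n) (fun i => e i n) k) (subpath0 q (pt n k)) := by
    refine (chain_congr (y := fun j => q (pt n j))
      (β := fun j => subpath q (pt n j) (pt n (j + 1))) k (by rw [gkJ, hcolJ]) fun j _ => ?_).trans
      ((chain_subpath q (pt n) k).trans (by rw [pt_zero]; exact (subpath0_peq _ _).symm))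
    apply small _ _ (by rw [gkJ, hcolJ]) (by rw [gkJ, hcolJ])
    · exact dist_lt_of_cost _ ((heη _ _).trans_lt hq4)
    · refine subpath_small q (c := c) (fun s t hst => ?_) (hpd j)
      rw [← Gq, ← Gq]
      apply hc1
      rw [Prod.dist_eq]
      simpa [hc] using hst
  have col0 : PEq (chain (fun i => g i 0) (fun i => e i 0) k) (Path.refl o) := by
    refine (chain_congr (y := fun _ => o)
      (β := fun _ => Path.refl o) k (by rw [gk0, hcol0]) fun j _ => ?_).trans
      (chain_refl o k)
    apply small _ _ (by rw [gk0, hcol0]) (by rw [gk0, hcol0])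
    · exact dist_lt_of_cost _ ((heη _ _).trans_lt hq4)
    · intro t; simpa using hr0
  have fin : PEq (τa.trans (subpath0 q (pt n k))) (chain (g k) (α k) n) := by
    refine ((PEq.comp row0 colJ).symm.trans L).trans ?_
    have ek : g k 0 = o := by rw [gk0, hcol0]
    have : ∀ {z w : X} (ρ : Path (g k 0) w) (κ : Path z (g k 0)), PEq κ (Path.refl o) →
        PEq (κ.trans ρ) ρ := by
      intro z w ρ κ hκ
      have h1 : PEq κ (Path.refl (g k 0)) := hκ.trans (PEq.of_fun fun t => by simp [ek])
      exact (PEq.comp h1 (PEq.rfl' ρ)).trans (PEq.of_hom (Path.Homotopic.refl_trans ρ))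
    exact this _ _ col0
  refine (mCost_le_of_peq fin).trans ?_
  rw [cost_chain]
  refine le_trans (le_of_eq ?_) (gs k hk)
  exact Finset.sum_congr rfl fun j _ => hα k j

lemma square_exists {Y : Type*} [TopologicalSpace Y] {o a b : Y} (τa : Path o a) (τb : Path o b)
    (q : Path a b) (H : (τa.trans q).Homotopic τb) :
    ∃ G : unitInterval × unitInterval → Y, Continuous G ∧ (∀ s, G (0, s) = τa s) ∧
      (∀ s, G (1, s) = τb (dbl s)) ∧ (∀ t, G (t, 0) = o) ∧ (∀ t, G (t, 1) = q t) := by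
  obtain ⟨F⟩ := H
  let pr : ℝ → unitInterval := Set.projIcc 0 1 zero_le_one
  have hpr : Continuous pr := continuous_projIcc
  let u : unitInterval × unitInterval → unitInterval := fun p => pr (p.1 * min 1 (2 - 2 * (p.2 : ℝ)))
  let v : unitInterval × unitInterval → unitInterval :=
    fun p => pr ((1 - p.1) * p.2 / 2 + p.1 * min 1 (2 * (p.2 : ℝ)))
  have hu : Continuous u := by dsimp only [u]; fun_prop
  have hv : Continuous v := by dsimp only [v]; fun_prop
  have pr0 : pr 0 = 0 := Set.projIcc_of_le_left _ le_rfl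
  have pr1 : pr 1 = 1 := Set.projIcc_of_right_le _ le_rfl
  refine ⟨fun p => F (u p, v p), by fun_prop, fun s => ?_, fun s => ?_, fun t => ?_, fun t => ?_⟩
  · have h1 : u (0, s) = 0 := by simp [u, pr0]
    have h2 : v (0, s) = pr (s / 2) := by simp [v]
    simp only [h1, h2]
    rw [F.apply_zero]
    have hs : (s : ℝ) / 2 ∈ Set.Icc (0 : ℝ) 1 := ⟨by linarith [s.2.1], by linarith [s.2.2]⟩
    have h3 : pr (s / 2) = ⟨s / 2, hs⟩ := Set.projIcc_of_mem _ hs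
    rw [h3]
    show (τa.trans q) _ = _
    rw [Path.trans_apply, dif_pos (by show (s : ℝ) / 2 ≤ 1 / 2; linarith [s.2.2])]
    congr 1
    apply Subtype.ext
    show 2 * ((s : ℝ) / 2) = s
    ring
  · have h2 : v (1, s) = dbl s := by
      simp only [v, pr, dbl]
      apply Subtype.ext
      rw [Set.coe_projIcc, Set.coe_projIcc]
      have := s.2.1
      simp
    simp only [h2]
    by_cases hs : (s : ℝ) ≤ 1 / 2
    · have h1 : u (1, s) = 1 := by
        simp only [u]
        rw [min_eq_left (by linarith)]
        simp [pr1]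
      rw [h1, F.apply_one]; rfl
    · have h3 : dbl s = 1 := Set.projIcc_of_right_le _ (by linarith)
      rw [h3, F.target]; simp
  · have h2 : v (t, 0) = 0 := by simp [v, pr0]
    simp only [h2]
    exact F.source _
  · have h1 : u (t, 1) = 0 := by simp [u, pr0]
    simp only [h1]
    rw [F.apply_zero]
    have hs : ((1 : ℝ) + t) / 2 ∈ Set.Icc (0 : ℝ) 1 := ⟨by linarith [t.2.1], by linarith [t.2.2]⟩
    have h3 : v (t, 1) = ⟨((1 : ℝ) + t) / 2, hs⟩ := by
      rw [← Set.projIcc_of_mem zero_le_one hs]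
      simp only [v, pr]
      congr 1
      rw [min_eq_left (by simp)]
      simp; ring
    rw [h3]
    show (τa.trans q) _ = _
    by_cases ht : (t : ℝ) = 0
    · have : t = 0 := Subtype.ext ht
      subst this
      rw [Path.trans_apply, dif_pos (by simp)]
      simp
    · have : 0 < (t : ℝ) := lt_of_le_of_ne t.2.1 (Ne.symm ht)
      rw [Path.trans_apply, dif_neg (by show ¬ ((1 : ℝ) + t) / 2 ≤ 1 / 2; linarith)]
      congr 1
      apply Subtype.ext
      show 2 * (((1 : ℝ) + t) / 2) - 1 = t
      ring

lemma quasi (hcomp : IsCompact X)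
    (hpoly : ∃ (n : ℕ) (P : Fin n → Finset E2), X = ⋃ i, convexHull ℝ (↑(P i) : Set E2))
    {o a b : X} (τa : Path o a) (τb : Path o b) (q : Path a b) {ℓ ζ : ℝ} (hℓ : 0 ≤ ℓ) (hζ : 0 ≤ ζ)
    (hq : ∀ s t : unitInterval, dist (q s : E2) (q t) ≤ ℓ * |(s : ℝ) - t|)
    (ho : ∀ q' : Path a b, q.Homotopic q' → ENNReal.ofReal ℓ ≤ cost q')
    (ha : cost τa ≤ ENNReal.ofReal ζ) (hb : cost τb ≤ ENNReal.ofReal ζ)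
    (H : (τa.trans q).Homotopic τb) (t : unitInterval) :
    mCost (τa.trans (subpath0 q t)) ≤ ENNReal.ofReal ζ := by
  obtain ⟨G, hG, G0, G1, Go, Gq⟩ := square_exists τa τb q H
  apply ENNReal.le_of_forall_pos_le_add
  intro ε hε _
  have hε' : (0 : ℝ) < ε := hε
  obtain ⟨c, hc, h⟩ := grid_core hcomp hpoly τa τb q hℓ hζ hq ho ha hb G hG G0 G1 Go Gq
    (ε := ε / 2) (by positivity)
  obtain ⟨n, hn⟩ := exists_nat_one_div_lt (show 0 < min c (ε / 2 / (ℓ + 1)) by positivity)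
  have hn' : (1 : ℝ) / ((n + 1 : ℕ) : ℝ) < min c (ε / 2 / (ℓ + 1)) := by push_cast; exact hn
  have hnR : (0 : ℝ) < ((n + 1 : ℕ) : ℝ) := by positivity
  generalize n + 1 = m at hn' hnR
  have hm : 0 < m := by exact_mod_cast hnR
  set k := ⌊(t : ℝ) * m⌋₊ with hk
  have ht0 := t.2.1
  have k1 : (k : ℝ) ≤ t * m := Nat.floor_le (by positivity)
  have k2 : (t : ℝ) * m < k + 1 := Nat.lt_floor_add_one _
  have hkm : k ≤ m := by
    have : (k : ℝ) ≤ m := k1.trans (mul_le_of_le_one_left hnR.le t.2.2)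
    exact_mod_cast this
  have h1 := h m hm (hn'.trans_le (min_le_left _ _)) k hkm
  have hP : PEq (τa.trans (subpath0 q t)) ((τa.trans (subpath0 q (pt m k))).trans (subpath q (pt m k) t)) := by
    refine PEq.trans ?_ (trans_assoc' _ _ _).symm
    refine PEq.comp (PEq.rfl' _) ?_
    exact (subpath0_peq q t).trans ((subpath_trans q 0 (pt m k) t).symm.trans
      (PEq.comp (subpath0_peq q _).symm (PEq.rfl' _)))
  rw [mCost_congr hP]
  refine (mCost_trans_le _ _).trans ?_
  have h2 := cost_subpath_lip hℓ q hq (pt m k) t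
  have h3 : ℓ * |(t : ℝ) - pt m k| ≤ ε / 2 := by
    rw [pt_of_le hm hkm]
    have e1 : (k : ℝ) / m ≤ t := by rw [div_le_iff₀ hnR]; exact k1
    have e2 : (t : ℝ) - k / m ≤ 1 / m := by
      have : (t : ℝ) ≤ (k + 1) / m := by rw [le_div_iff₀ hnR]; exact k2.le
      rw [add_div] at this; linarith
    rw [abs_of_nonneg (by linarith)]
    have e3 := hn'.trans_le (min_le_right _ _)
    rw [lt_div_iff₀ (by positivity)] at e3
    have : (0 : ℝ) < 1 / m := by positivity
    nlinarith
  refine (add_le_add h1 (h2.trans (ENNReal.ofReal_le_ofReal h3))).trans (le_of_eq ?_)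
  rw [← ENNReal.ofReal_add (by positivity) (by positivity), show ζ + (ε : ℝ) / 2 + ε / 2 = ζ + ε by ring,
    ENNReal.ofReal_add hζ hε'.le]
  simp


end

section
variable {X : Set E2}

def hf (t : unitInterval) : unitInterval := ⟨(t : ℝ) / 2, by linarith [t.2.1], by linarith [t.2.2]⟩
def hg (t : unitInterval) : unitInterval :=
  ⟨(1 + (t : ℝ)) / 2, by linarith [t.2.1], by linarith [t.2.2]⟩

lemma hf_or_hg (t : unitInterval) : (∃ s, t = hf s) ∨ ∃ s, t = hg s := by
  have h0 := t.2.1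
  have h1 := t.2.2
  by_cases h : (t : ℝ) ≤ 1 / 2
  · exact Or.inl ⟨⟨2 * t, by linarith, by linarith⟩,
      Subtype.ext (show (t : ℝ) = 2 * t / 2 by ring)⟩
  · exact Or.inr ⟨⟨2 * t - 1, by linarith, by linarith⟩,
      Subtype.ext (show (t : ℝ) = (1 + (2 * t - 1)) / 2 by ring)⟩

section
variable {Y : Type*} [TopologicalSpace Y] {a b c : Y}

lemma trans_hf (p : Path a b) (q : Path b c) (t : unitInterval) :
    (p.trans q) (hf t) = p t := by
  rw [Path.trans_apply, dif_pos (by show (t : ℝ) / 2 ≤ 1 / 2; linarith [t.2.2])]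
  congr 1
  apply Subtype.ext
  show 2 * ((t : ℝ) / 2) = t
  ring

lemma trans_hg (p : Path a b) (q : Path b c) (t : unitInterval) :
    (p.trans q) (hg t) = q t := by
  by_cases ht : (t : ℝ) = 0
  · have : t = 0 := Subtype.ext ht
    subst this
    rw [Path.trans_apply, dif_pos (by simp [hg])]
    simp [hg]
  · have : 0 < (t : ℝ) := lt_of_le_of_ne t.2.1 (Ne.symm ht)
    rw [Path.trans_apply, dif_neg (by show ¬ ((1 : ℝ) + t) / 2 ≤ 1 / 2; linarith)]
    congr 1
    apply Subtype.ext
    show 2 * (((1 : ℝ) + t) / 2) - 1 = t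
    ring

lemma sub_hf (p : Path a b) (q : Path b c) (s t : unitInterval) :
    PEq (subpath (p.trans q) (hf s) (hf t)) (subpath p s t) := by
  refine PEq.of_fun fun u => ?_
  refine Eq.trans ?_ (trans_hf p q _)
  show (p.trans q) _ = _
  congr 1
  apply Subtype.ext
  show (1 - (u : ℝ)) * (s / 2) + u * (t / 2) = ((1 - (u : ℝ)) * s + u * t) / 2
  ring

lemma sub_hg (p : Path a b) (q : Path b c) (s t : unitInterval) :
    PEq (subpath (p.trans q) (hg s) (hg t)) (subpath q s t) := by
  refine PEq.of_fun fun u => ?_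
  refine Eq.trans ?_ (trans_hg p q _)
  show (p.trans q) _ = _
  congr 1
  apply Subtype.ext
  show (1 - (u : ℝ)) * ((1 + s) / 2) + u * ((1 + t) / 2) = (1 + ((1 - (u : ℝ)) * s + u * t)) / 2
  ring

lemma hf_zero : hf 0 = 0 := Subtype.ext (by simp [hf])
lemma hf_one : hf 1 = hg 0 := Subtype.ext (by simp [hf, hg])

lemma sub0_hf (p : Path a b) (q : Path b c) (t : unitInterval) :
    PEq (subpath0 (p.trans q) (hf t)) (subpath0 p t) := by
  have := sub_hf p q 0 t
  rw [hf_zero] at this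
  exact (subpath0_peq _ _).trans (this.trans (subpath0_peq _ _).symm)

lemma sub0_hg (p : Path a b) (q : Path b c) (t : unitInterval) :
    PEq (subpath0 (p.trans q) (hg t)) (p.trans (subpath0 q t)) := by
  refine (subpath0_peq _ _).trans ((subpath_trans _ 0 (hg 0) _).symm.trans (PEq.comp ?_ ?_))
  · have := sub_hf p q 0 1
    rw [hf_zero, hf_one] at this
    exact this.trans (subpath_full p)
  · exact (sub_hg p q 0 t).trans (subpath0_peq _ _).symm

end

lemma main_aux {X : Set E2} (hcomp : IsCompact X)
    (hpoly : ∃ (n : ℕ) (P : Fin n → Finset E2), X = ⋃ i, convexHull ℝ (↑(P i) : Set E2))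
    (hmin : ∀ (a b : X) (p : Path a b), ∃ q : Path a b, p.Homotopic q ∧
      ∀ r : Path a b, p.Homotopic r → cost q ≤ cost r)
    (xstar : X) {ζ : ℝ} (hζ : 0 ≤ ζ) (N : ℕ)
    (x : ℕ → X) (hxN : x (N + 1) = x 0)
    (ςs : Path xstar (x 0)) (hcs : cost ςs ≤ ENNReal.ofReal ζ)
    (σstar : ∀ i : ℕ, Path (x i) (x (i + 1)))
    (hfeas : FeasibleTMV ζ N x hxN ςs σstar)
    (hbest : ∀ σ : ∀ i : ℕ, Path (x i) (x (i + 1)), FeasibleTMV ζ N x hxN ςs σ →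
      cost (chain x σstar (N + 1)) ≤ cost (chain x σ (N + 1))) :
    ∀ i ≤ N, IsOptimal (σstar i) := by
  have hF : ∀ m n, n + m = N + 1 → ∀ t : unitInterval,
      mCost (ςs.trans (subpath0 (chain x σstar n) t)) ≤ ENNReal.ofReal ζ := by
    intro m
    induction m with
    | zero => intro n hn t; obtain rfl : n = N + 1 := by omega
              exact hfeas.1 t
    | succ m ih =>
      intro n hn t
      have h1 := ih (n + 1) (by omega) (hf t)
      have e := mCost_congr (PEq.comp (PEq.rfl' ςs) (sub0_hf (chain x σstar n) (σstar n) t))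
      exact e.symm.le.trans h1
  have hτ : ∀ n, ∃ τ : Path xstar (x n), n ≤ N + 1 →
      (ςs.trans (chain x σstar n)).Homotopic τ ∧ cost τ ≤ ENNReal.ofReal ζ := by
    intro n
    obtain ⟨τ, h1, h2⟩ := hmin _ _ (ςs.trans (chain x σstar n))
    refine ⟨τ, fun hn => ⟨h1, ?_⟩⟩
    have h3 := hF (N + 1 - n) n (by omega) 1
    have e0 : PEq (subpath0 (chain x σstar n) 1) (chain x σstar n) :=
      (subpath0_peq (chain x σstar n) 1).trans (subpath_full (chain x σstar n))
    have e := mCost_congr (PEq.comp (PEq.rfl' ςs) e0)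
    have h4 : cost τ ≤ mCost (ςs.trans (chain x σstar n)) := le_iInf fun q' => h2 q'.1 q'.2
    exact h4.trans (e.symm.le.trans h3)
  choose τ hτ using hτ
  have hq : ∀ i, ∃ (q : Path (x i) (x (i + 1))) (ℓ : ℝ), i ≤ N → 0 ≤ ℓ ∧ (σstar i).Homotopic q ∧
      (∀ s t : unitInterval, dist (q s : E2) (q t) ≤ ℓ * |(s : ℝ) - t|) ∧
      ∀ q' : Path (x i) (x (i + 1)), q.Homotopic q' → ENNReal.ofReal ℓ ≤ cost q' := by
    intro i
    by_cases hi : i ≤ N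
    · obtain ⟨p, h1, h2⟩ := hmin _ _ (σstar i)
      obtain ⟨a1, a2⟩ := hτ i (by omega)
      obtain ⟨b1, b2⟩ := hτ (i + 1) (by omega)
      have hh : (σstar i).Homotopic ((τ i).symm.trans (τ (i + 1))) := by
        have c1 : PEq (τ (i + 1)) ((τ i).trans (σstar i)) :=
          (PEq.of_hom b1).symm.trans ((trans_assoc' ςs (chain x σstar i) (σstar i)).symm.trans
            (PEq.comp (PEq.of_hom a1) (PEq.rfl' _)))
        have c2 : PEq ((τ i).symm.trans (τ (i + 1))) (σstar i) :=
          (PEq.comp (PEq.rfl' _) c1).trans ((trans_assoc' _ _ _).symm.trans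
            ((PEq.comp (PEq.of_hom (Path.Homotopic.symm_trans (τ i))) (PEq.rfl' _)).trans
              (PEq.of_hom (Path.Homotopic.refl_trans _))))
        exact c2.symm.hom
      have hfin : cost p ≠ ⊤ := by
        have h3 := h2 _ hh
        rw [cost_trans, cost_symm] at h3
        exact (h3.trans_lt (ENNReal.add_lt_top.2 ⟨a2.trans_lt ENNReal.ofReal_lt_top,
          b2.trans_lt ENNReal.ofReal_lt_top⟩)).ne
      obtain ⟨q, e1, e2⟩ := lip_reparam p hfin
      refine ⟨q, (cost p).toReal, fun _ => ⟨ENNReal.toReal_nonneg, h1.trans e1, e2, fun q' hq' => ?_⟩⟩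
      rw [ENNReal.ofReal_toReal hfin]
      exact h2 _ ((h1.trans e1).trans hq')
    · exact ⟨σstar i, 0, fun h => absurd h hi⟩
  choose q ℓ hq using hq
  have hch : ∀ n ≤ N + 1, PEq (chain x σstar n) (chain x q n) := fun n hn =>
    chain_congr n rfl fun i hi => PEq.of_hom (hq i (by omega)).2.1
  have hF' : ∀ n ≤ N + 1, ∀ t : unitInterval,
      mCost (ςs.trans (subpath0 (chain x q n) t)) ≤ ENNReal.ofReal ζ := by
    intro n
    induction n with
    | zero =>
      intro _ t
      refine (mCost_le_of_peq (τ := ςs) ?_).trans hcs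
      exact (PEq.comp (PEq.rfl' ςs) (PEq.of_fun (τ := Path.refl (x 0)) fun _ => rfl)).trans
        (PEq.of_hom (Path.Homotopic.trans_refl _))
    | succ n ih =>
      intro hn t
      rcases hf_or_hg t with ⟨s, rfl⟩ | ⟨s, rfl⟩
      · have e := mCost_congr (PEq.comp (PEq.rfl' ςs) (sub0_hf (chain x q n) (q n) s))
        exact e.le.trans (ih (by omega) s)
      · obtain ⟨a1, a2⟩ := hτ n (by omega)
        obtain ⟨b1, b2⟩ := hτ (n + 1) hn
        obtain ⟨l0, l1, l2, l3⟩ := hq n (by omega)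
        have e1 : PEq (ςs.trans (chain x q n)) (τ n) :=
          (PEq.comp (PEq.rfl' ςs) (hch n (by omega)).symm).trans (PEq.of_hom a1)
        have e2 : PEq (ςs.trans (subpath0 (chain x q (n + 1)) (hg s))) ((τ n).trans (subpath0 (q n) s)) :=
          (PEq.comp (PEq.rfl' ςs) (sub0_hg (chain x q n) (q n) s)).trans
            ((trans_assoc' _ _ _).symm.trans (PEq.comp e1 (PEq.rfl' _)))
        rw [mCost_congr e2]
        refine quasi hcomp hpoly (τ n) (τ (n + 1)) (q n) l0 hζ l2 l3 a2 b2 ?_ s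
        refine PEq.hom (PEq.trans ?_ (PEq.of_hom b1))
        exact (PEq.comp e1.symm (PEq.rfl' (q n))).trans ((trans_assoc' _ _ _).trans
          (PEq.comp (PEq.rfl' ςs) (hch (n + 1) hn).symm))
  have hfe : FeasibleTMV ζ N x hxN ςs q := by
    refine ⟨hF' (N + 1) le_rfl, ?_⟩
    exact (PEq.comp (PEq.rfl' ςs) (hch (N + 1) le_rfl).symm).hom.trans hfeas.2
  have hb := hbest q hfe
  rw [cost_chain, cost_chain] at hb
  have hqle : ∀ i ≤ N, ∀ σ' : Path (x i) (x (i + 1)), (σstar i).Homotopic σ' →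
      cost (q i) ≤ cost σ' := by
    intro i hi σ' h'
    obtain ⟨l0, l1, l2, l3⟩ := hq i hi
    exact (cost_le_lip l0 (q i) l2).trans (l3 σ' (l1.symm.trans h'))
  have hqf : ∀ i ≤ N, cost (q i) ≠ ⊤ := fun i hi =>
    ((cost_le_lip (hq i hi).1 (q i) (hq i hi).2.2.1).trans_lt ENNReal.ofReal_lt_top).ne
  intro i hi σ' h'
  refine le_trans ?_ (hqle i hi σ' h')
  by_contra hlt
  push Not at hlt
  refine absurd hb (not_le.2 ?_)
  have hmem : i ∈ Finset.range (N + 1) := Finset.mem_range.2 (by omega)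
  rw [← Finset.add_sum_erase _ _ hmem, ← Finset.add_sum_erase _ (fun j => cost (σstar j)) hmem]
  have hj : ∀ j ∈ (Finset.range (N + 1)).erase i, j ≤ N := fun j hj => by
    have := Finset.mem_range.1 (Finset.mem_of_mem_erase hj); omega
  refine ENNReal.add_lt_add_of_lt_of_le ?_ hlt (Finset.sum_le_sum fun j hjm =>
    hqle j (hj j hjm) _ (Path.Homotopic.refl _))
  exact ENNReal.sum_ne_top.2 fun j hjm => hqf j (hj j hjm)


end

/-- in a free space where every path-homotopy class contains a path of
minimal cost, every subpath `σ_i` of a cost-minimal feasible TMV loop is an optimal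
homotopic path. -/
theorem tmv_optimal_subpaths {X : Set E2} (hcomp : IsCompact X)
    (hpc : IsPathConnected X)
    (hpoly : ∃ (n : ℕ) (P : Fin n → Finset E2), X = ⋃ i, convexHull ℝ (↑(P i) : Set E2))
    (hmin : ∀ (a b : X) (p : Path a b), ∃ q : Path a b, p.Homotopic q ∧
      ∀ r : Path a b, p.Homotopic r → cost q ≤ cost r)
    (xstar : X) {ζ : ℝ} (hζ : 0 ≤ ζ) (N : ℕ)
    (x : ℕ → X) (hxN : x (N + 1) = x 0)
    (ςs : Path xstar (x 0)) (hcs : cost ςs ≤ ENNReal.ofReal ζ)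
    (σstar : ∀ i : ℕ, Path (x i) (x (i + 1)))
    (hfeas : FeasibleTMV ζ N x hxN ςs σstar)
    (hbest : ∀ σ : ∀ i : ℕ, Path (x i) (x (i + 1)), FeasibleTMV ζ N x hxN ςs σ →
      cost (chain x σstar (N + 1)) ≤ cost (chain x σ (N + 1))) :
    ∀ i ≤ N, IsOptimal (σstar i) := by
  exact main_aux hcomp hpoly hmin xstar hζ N x hxN ςs hcs σstar hfeas hbest

end THPP
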